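/- arXiv:2203.06205 — 3 statements merged into one kernel-verified Lean document; each statement's English description precedes it below -/
import Mathlib

section
/- Let k be a field of characteristic p > 0 and let K be a function field over k. Let d ≥ 2 and 0 ≤ e ≤ d − 2 be integers with p not dividing d. For σ ∈ L (L a field extension of K), let f_σ : P¹(L) → P¹(L) be the degree-d map given by f_σ(x) = (x^d − σ)/x^e for x ∈ L, x ≠ 0, with f_σ(∞) = ∞, and f_σ(0) = ∞ if e ≥ 1 while f_σ(0) = −σ if e = 0. Then for every integer D ≥ 1 there exists a bound B such that: for every field extension L/K with [L : K] ≤ D and every σ ∈ L for which f_σ is not isotrivial over k, the number of preperiodic points of f_σ in P¹(L) is at most B. -/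
open Polynomial

/-- A point is preperiodic for a self-map if its forward orbit is finite. -/
def IsPreperiodic {S : Type*} (f : S → S) (x : S) : Prop :=
  (Set.range fun n : ℕ => f^[n] x).Finite

/-- The action of a polynomial on `P¹(L) = L ∪ {∞}`, with `none` playing the role of `∞`. -/
def polyP1Map {L : Type*} [Field L] (f : Polynomial L) : Option L → Option L
  | none => none
  | some x => some (f.eval x)

open scoped Classical in
/-- The self-map of `P¹(F) = F ∪ {∞}` induced by the rational function `p/q`. -/
noncomputable def ratP1Map {F : Type*} [Field F] (p q : Polynomial F) :
    Option F → Option F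
  | none =>
      if q.degree < p.degree then none
      else if p.degree < q.degree then some 0
      else some (p.leadingCoeff / q.leadingCoeff)
  | some x => if q.eval x = 0 then none else some (p.eval x / q.eval x)

/-- The Möbius transformation `z ↦ (az + b)/(cz + d)` as a self-map of `P¹(F)`. -/
noncomputable def mobiusMap {F : Type*} [Field F] (a b c d : F) : Option F → Option F :=
  ratP1Map (C a * X + C b) (C c * X + C d)

/-- `x` is algebraic over the image of `ι`. -/
def AlgebraicOver {k F : Type*} [Field k] [Field F] (ι : k →+* F) (x : F) : Prop :=
  ∃ p : Polynomial k, p ≠ 0 ∧ (p.map ι).IsRoot x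

/-- A self-map `g` of `P¹(F)` is isotrivial over `k` (w.r.t. `ι : k →+* F`, `F` playing the
role of an algebraic closure of `L`) if some Möbius conjugate `γ⁻¹ ∘ g ∘ γ` of `g` is given by a
rational function all of whose coefficients are algebraic over `k`. -/
def IsotrivialMap {k F : Type*} [Field k] [Field F] (ι : k →+* F)
    (g : Option F → Option F) : Prop :=
  ∃ a b c d : F, a * d - b * c ≠ 0 ∧
    ∃ p q : Polynomial F, q ≠ 0 ∧
      (∀ n, AlgebraicOver ι (p.coeff n)) ∧ (∀ n, AlgebraicOver ι (q.coeff n)) ∧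
      (mobiusMap d (-b) (-c) a) ∘ g ∘ (mobiusMap a b c d) = ratP1Map p q

section part1
open Polynomial

/-- the map -/
noncomputable def fm {F : Type*} [Field F] (d e : ℕ) (σ : F) : Option F → Option F :=
  ratP1Map (X ^ d - C σ) (X ^ e)

/-- the affine formula -/
def fa {F : Type*} [Field F] (d e : ℕ) (σ x : F) : F := (x ^ d - σ) / x ^ e

def Pre {F : Type*} [Field F] (d e : ℕ) (σ x : F) : Prop := IsPreperiodic (fm d e σ) (some x)

section dyn
variable {F : Type*} [Field F] {d e : ℕ} {σ x : F}

lemma fm_none (he : e + 2 ≤ d) : fm d e σ none = none := by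
  have h : (X ^ e : F[X]).degree < (X ^ d - C σ : F[X]).degree := by
    rw [degree_X_pow_sub_C (by omega), degree_X_pow]; exact_mod_cast (by omega)
  simp only [fm, ratP1Map]; rw [if_pos h]

lemma fm_some (hx : x ≠ 0) : fm d e σ (some x) = some (fa d e σ x) := by
  simp [fm, ratP1Map, fa, hx]

lemma fm_zero (he : e ≠ 0) : fm d e σ (some 0) = none := by
  simp [fm, ratP1Map, he]

lemma fm_zero' : fm d 0 σ (some x) = some (fa d 0 σ x) := by
  simp [fm, ratP1Map, fa]

lemma isPreperiodic_step {S : Type*} {f : S → S} {x : S} (h : IsPreperiodic f x) :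
    IsPreperiodic f (f x) := by
  refine h.subset ?_
  rintro _ ⟨n, rfl⟩
  exact ⟨n + 1, by simp [Function.iterate_succ_apply]⟩

lemma Pre.step (h : Pre d e σ x) (hx : x ≠ 0) : Pre d e σ (fa d e σ x) := by
  have := isPreperiodic_step h
  rwa [fm_some hx] at this

lemma fa_map {F' : Type*} [Field F'] (ρ : F →+* F') : ρ (fa d e σ x) = fa d e (ρ σ) (ρ x) := by
  simp [fa]

lemma fm_map {F' : Type*} [Field F'] (ρ : F →+* F') (he : e + 2 ≤ d) (y : Option F) :
    (fm d e σ y).map ρ = fm d e (ρ σ) (y.map ρ) := by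
  cases y with
  | none => simp [fm_none he]
  | some x =>
    by_cases hx : x = 0
    · subst hx
      by_cases h : e = 0
      · subst h; simp [fm_zero', fa_map]
      · simp [fm_zero h]
    · have : ρ x ≠ 0 := by simpa using hx
      simp [fm_some hx, fm_some this, fa_map]

lemma fm_map_iter {F' : Type*} [Field F'] (ρ : F →+* F') (he : e + 2 ≤ d) (y : Option F) (n : ℕ) :
    ((fm d e σ)^[n] y).map ρ = (fm d e (ρ σ))^[n] (y.map ρ) := by
  induction n generalizing y with
  | zero => rfl
  | succ n ih => rw [Function.iterate_succ_apply, Function.iterate_succ_apply, ih, fm_map ρ he]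

lemma Pre.map {F' : Type*} [Field F'] (ρ : F →+* F') (he : e + 2 ≤ d) (h : Pre d e σ x) :
    Pre d e (ρ σ) (ρ x) := by
  have := h.image (Option.map ρ)
  refine this.subset ?_
  rintro _ ⟨n, rfl⟩
  exact ⟨_, ⟨n, rfl⟩, by simpa using fm_map_iter ρ he (some x) n⟩

lemma Pre.of_map {F' : Type*} [Field F'] (ρ : F →+* F') (he : e + 2 ≤ d)
    (h : Pre d e (ρ σ) (ρ x)) : Pre d e σ x := by
  refine Set.Finite.of_finite_image (f := Option.map ρ) ?_ ?_
  · refine h.subset ?_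
    rintro _ ⟨_, ⟨n, rfl⟩, rfl⟩
    exact ⟨n, by simpa using (fm_map_iter ρ he (some x) n).symm⟩
  · exact (Option.map_injective ρ.injective).injOn

variable {Γ : Type*} [LinearOrderedCommGroupWithZero Γ]

lemma val_fa_big (he : e + 2 ≤ d) (v : Valuation F Γ) (h1 : 1 < v x) (h2 : v σ < v x ^ d) :
    v (fa d e σ x) = v x ^ (d - e) := by
  have hx : v x ≠ 0 := (zero_lt_one.trans h1).ne'
  rw [fa, map_div₀, map_pow, Valuation.map_sub_eq_of_lt_left v (by simpa using h2), map_pow,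
    div_eq_iff (pow_ne_zero _ hx), ← pow_add]
  congr 1; omega

lemma not_pre_of_big (he : e + 2 ≤ d) (v : Valuation F Γ) (h1 : 1 < v x) (h2 : v σ < v x ^ d) :
    ¬ Pre d e σ x := by
  intro hpre
  have key : ∀ y : F, 1 < v y → v σ < v y ^ d →
      y ≠ 0 ∧ v y < v (fa d e σ y) ∧ v σ < v (fa d e σ y) ^ d := by
    intro y hy1 hy2
    have hlt : v y < v (fa d e σ y) := by
      rw [val_fa_big he v hy1 hy2]
      calc v y = v y ^ 1 := (pow_one _).symm
        _ < v y ^ (d - e) := pow_lt_pow_right₀ hy1 (by omega)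
    refine ⟨?_, hlt, hy2.trans_le (pow_le_pow_left₀ zero_le hlt.le _)⟩
    rintro rfl; simp at hy1
  have hit : ∀ n, ∃ y : F, (fm d e σ)^[n] (some x) = some y ∧ 1 < v y ∧ v σ < v y ^ d := by
    intro n
    induction n with
    | zero => exact ⟨x, rfl, h1, h2⟩
    | succ n ih =>
      obtain ⟨y, hy, h3, h4⟩ := ih
      obtain ⟨a, b, c⟩ := key y h3 h4
      exact ⟨_, by rw [Function.iterate_succ_apply', hy, fm_some a], h3.trans b, c⟩
  choose y hy h3 h4 using hit
  have hsucc : ∀ n, v (y n) < v (y (n+1)) := by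
    intro n
    obtain ⟨a, b, c⟩ := key _ (h3 n) (h4 n)
    have : some (y (n+1)) = some (fa d e σ (y n)) := by
      rw [← hy (n+1), Function.iterate_succ_apply', hy n, fm_some a]
    rw [Option.some.inj this]; exact b
  have hmono : StrictMono fun n => v (y n) := strictMono_nat_of_lt_succ hsucc
  refine Set.infinite_range_of_injective (f := fun n : ℕ => (fm d e σ)^[n] (some x)) ?_ hpre
  intro m n hmn
  have : y m = y n := Option.some.inj (by rw [← hy m, ← hy n]; exact hmn)
  exact hmono.injective (by simp [this])

end dyn

end part1

section part2
open Polynomial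
open scoped NNReal

/-- valued field with residue field k -/
structure Loc (k Λ : Type*) [Field k] [Field Λ] [Algebra k Λ] where
  v : Valuation Λ ℝ≥0
  hk : ∀ c : k, c ≠ 0 → v (algebraMap k Λ c) = 1
  hres : ∀ y : Λ, v y ≤ 1 → ∃ c : k, v (y - algebraMap k Λ c) < 1

section near
variable {Λ : Type*} [Field Λ] (v : Valuation Λ ℝ≥0)

def Near (a b : Λ) : Prop := v (a - b) < 1

variable {v}
lemma Near.symm {a b : Λ} (h : Near v a b) : Near v b a := by
  unfold Near at *; rwa [Valuation.map_sub_swap]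
lemma Near.refl (a : Λ) : Near v a a := by simp [Near]
lemma Near.trans {a b c : Λ} (h : Near v a b) (h' : Near v b c) : Near v a c := by
  unfold Near at *
  rw [← sub_add_sub_cancel a b c]
  exact Valuation.map_add_lt v h h'
lemma Near.add {a b a' b' : Λ} (h : Near v a b) (h' : Near v a' b') : Near v (a + a') (b + b') := by
  unfold Near at *
  rw [add_sub_add_comm]
  exact Valuation.map_add_lt v h h'
lemma Near.mul {a b a' b' : Λ} (h : Near v a b) (h' : Near v a' b') (h1 : v a ≤ 1)
    (h2 : v b' ≤ 1) : Near v (a * a') (b * b') := by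
  unfold Near at *
  have : a * a' - b * b' = a * (a' - b') + (a - b) * b' := by ring
  rw [this]
  refine Valuation.map_add_lt v ?_ ?_
  · rw [map_mul]; exact mul_lt_one_of_nonneg_of_lt_one_right h1 zero_le h'
  · rw [map_mul]; exact mul_lt_one_of_nonneg_of_lt_one_left zero_le h h2
lemma Near.le_one {a b : Λ} (h : Near v a b) (hb : v b ≤ 1) : v a ≤ 1 := by
  have : a = (a - b) + b := by ring
  rw [this]; exact Valuation.map_add_le v h.le hb
lemma Near.eq_one {a b : Λ} (h : Near v a b) (hb : v b = 1) : v a = 1 := by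
  have : a = (a - b) + b := by ring
  rw [this, Valuation.map_add_eq_of_lt_right v (by rw [hb]; exact h), hb]
lemma Near.pow {a b : Λ} (h : Near v a b) (hb : v b ≤ 1) (n : ℕ) : Near v (a ^ n) (b ^ n) := by
  induction n with
  | zero => simpa using Near.refl _
  | succ n ih =>
    rw [pow_succ, pow_succ]
    exact ih.mul h (by rw [map_pow]; exact pow_le_one₀ zero_le (h.le_one hb)) hb
lemma Near.sum {ι : Type*} (S : Finset ι) {a b : ι → Λ} (h : ∀ i ∈ S, Near v (a i) (b i)) :
    Near v (∑ i ∈ S, a i) (∑ i ∈ S, b i) := by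
  classical
  induction S using Finset.induction_on with
  | empty => simpa using Near.refl _
  | insert i S hi ih =>
    rw [Finset.sum_insert hi, Finset.sum_insert hi]
    exact (h i (by simp)).add (ih fun j hj => h j (by simp [hj]))

/-- key expansion computation -/
lemma val_expand {d e : ℕ} (he : e + 2 ≤ d) (hd : v (d : Λ) = 1) {x y : Λ} (hx : v x = 1)
    (hxy : Near v x y) (hxd : Near v (x ^ d) 1) :
    v ((x ^ d - 1) * y ^ e - (y ^ d - 1) * x ^ e) = v (x - y) := by
  have hy : v y = 1 := hxy.symm.eq_one hx
  have key : (x ^ d - 1) * y ^ e - (y ^ d - 1) * x ^ e =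
      (x - y) * (x ^ e * y ^ e * (∑ i ∈ Finset.range (d - e), x ^ i * y ^ (d - e - 1 - i)) +
        ∑ i ∈ Finset.range e, x ^ i * y ^ (e - 1 - i)) := by
    have h1 := (Commute.all x y).mul_geom_sum₂ (d - e)
    have h2 := (Commute.all x y).mul_geom_sum₂ e
    have h3 : x ^ d = x ^ (d - e) * x ^ e := by rw [← pow_add]; congr 1; omega
    have h4 : y ^ d = y ^ (d - e) * y ^ e := by rw [← pow_add]; congr 1; omega
    rw [mul_add, mul_left_comm, h1, h2, h3, h4]; ring
  have hS : ∀ n : ℕ, Near v (∑ i ∈ Finset.range n, x ^ i * y ^ (n - 1 - i)) (n * x ^ (n - 1)) := by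
    intro n
    rw [← geom_sum₂_self x n]
    refine Near.sum _ fun i _ => ?_
    exact (Near.refl _).mul (hxy.symm.pow hx.le _) (by simp [hx]) (by simp [hx])
  have hn : ∀ n : ℕ, v (n : Λ) ≤ 1 := fun n => by
    induction n with
    | zero => simp
    | succ n ih => push_cast; exact Valuation.map_add_le v ih (by simp)
  have hN : Near v (x * (x ^ e * y ^ e *
      (∑ i ∈ Finset.range (d - e), x ^ i * y ^ (d - e - 1 - i)) +
        ∑ i ∈ Finset.range e, x ^ i * y ^ (e - 1 - i))) (d * x ^ e) := by
    have h1 : Near v (x ^ e * y ^ e *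
      (∑ i ∈ Finset.range (d - e), x ^ i * y ^ (d - e - 1 - i)) +
        ∑ i ∈ Finset.range e, x ^ i * y ^ (e - 1 - i))
        (x ^ e * x ^ e * ((d - e : ℕ) * x ^ (d - e - 1)) + e * x ^ (e - 1)) := by
      refine Near.add (Near.mul ?_ (hS _) ?_ ?_) (hS _)
      · exact (Near.refl _).mul (hxy.symm.pow hx.le _) (by simp [hx]) (by simp [hx])
      · simp [hx, hy]
      · simpa [hx] using hn _
    have h2 := (Near.refl (v := v) x).mul h1 hx.le (by
      refine Valuation.map_add_le v ?_ ?_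
      · simpa [hx] using hn _
      · simpa [hx] using hn _)
    refine h2.trans ?_
    have h3 : x * (x ^ e * x ^ e * ((d - e : ℕ) * x ^ (d - e - 1)) + e * x ^ (e - 1)) =
        ((d - e : ℕ) * x ^ e) * x ^ d + e * x ^ e := by
      have h5 : x ^ d = x * x ^ (d - e - 1) * x ^ e := by
        rw [← pow_succ', ← pow_add]; congr 1; omega
      have h6 : (e : Λ) * x ^ e = x * (e * x ^ (e - 1)) := by
        rcases Nat.eq_zero_or_pos e with h | h
        · simp [h]
        · rw [mul_left_comm, ← pow_succ']; congr 2; omega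
      rw [h6, h5]; ring
    have h4 : (d : Λ) * x ^ e = ((d - e : ℕ) * x ^ e) * 1 + e * x ^ e := by
      rw [Nat.cast_sub (by omega)]; ring
    rw [h3, h4]
    refine Near.add ?_ (Near.refl _)
    exact (Near.refl _).mul hxd (by simpa [hx] using hn _) (by simp)
  have := hN.eq_one (by simp [hd, hx])
  rw [map_mul, hx, one_mul] at this
  rw [key, map_mul, this, mul_one]

variable {d e : ℕ} {s : Λ} (he : e + 2 ≤ d) (hs : s ≠ 0) (hs1 : v s < 1)
include he hs hs1

lemma pre_le_one {x : Λ} (h : Pre d e (s ^ d)⁻¹ x) : v (s * x) ≤ 1 := by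
  by_contra hc
  push Not at hc
  have hs' : 0 < v s := (Valuation.pos_iff v).2 hs
  rw [map_mul] at hc
  have hx0 : 0 < v x := by
    by_contra h0
    rw [not_lt, nonpos_iff_eq_zero] at h0
    simp [h0] at hc
  refine not_pre_of_big he v ?_ ?_ h
  · calc 1 < v s * v x := hc
      _ ≤ 1 * v x := by gcongr
      _ = v x := one_mul _
  · rw [map_inv₀, map_pow, ← inv_pow]
    refine pow_lt_pow_left₀ ?_ zero_le (by omega)
    rw [inv_lt_iff_one_lt_mul₀ hs']; first | exact hc | rwa [mul_comm]

omit he hs1 in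
lemma fa_identity {m : ℕ} (hm : m + e + 1 = d) {x : Λ} (hx : x ≠ 0) :
    s ^ m * (s * fa d e (s ^ d)⁻¹ x) * (s * x) ^ e = (s * x) ^ d - 1 := by
  subst hm
  unfold fa
  field_simp
  ring

lemma pre_near_one {x : Λ} (h : Pre d e (s ^ d)⁻¹ x) (hx : x ≠ 0) :
    v ((s * x) ^ d - 1) < 1 := by
  obtain ⟨m, hm⟩ : ∃ m, m + e + 1 = d := ⟨d - e - 1, by omega⟩
  rw [← fa_identity hs hm hx]
  simp only [map_mul v (_ * _), map_pow]
  rw [map_mul v (s ^ m), map_pow]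
  have h1 := pre_le_one he hs hs1 h
  have h2 := pre_le_one he hs hs1 (h.step hx)
  have h3 : v s ^ m < 1 := pow_lt_one₀ zero_le hs1 (by omega)
  have h4 := pow_le_one₀ (n := e) zero_le h1
  calc _ ≤ v s ^ m * 1 * 1 := by gcongr
    _ < 1 := by simpa using h3

lemma pre_eq_one {x : Λ} (h : Pre d e (s ^ d)⁻¹ x) (hx : x ≠ 0) : v (s * x) = 1 := by
  have h1 : Near v ((s * x) ^ d) 1 := pre_near_one he hs hs1 h hx
  have := h1.eq_one (by simp)
  rw [map_pow] at this
  exact (pow_eq_one_iff_of_nonneg zero_le (by omega)).1 this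

lemma pre_diff (hd : v (d : Λ) = 1) {x y : Λ} (h : Pre d e (s ^ d)⁻¹ x) (h' : Pre d e (s ^ d)⁻¹ y)
    (hx : x ≠ 0) (hy : y ≠ 0) (hn : Near v (s * x) (s * y)) :
    v (s * x - s * y) =
      v s ^ (d - e - 1) * v (s * fa d e (s ^ d)⁻¹ x - s * fa d e (s ^ d)⁻¹ y) := by
  have hm : (d - e - 1) + e + 1 = d := by omega
  have h1 := pre_eq_one he hs hs1 h hx
  have h2 := pre_eq_one he hs hs1 h' hy
  rw [← val_expand he hd h1 hn (pre_near_one he hs hs1 h hx), ← fa_identity hs hm hx,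
    ← fa_identity hs hm hy]
  have : ∀ a b c p q : Λ, p * a * b * c - p * q * c * b = p * (a - q) * (b * c) := by
    intros; ring
  rw [this, map_mul, map_mul, map_mul, map_pow, map_pow, map_pow, h1, h2]; simp

lemma rigid (hd : v (d : Λ) = 1) (R : Λ → Λ → Prop)
    (hR : ∀ x y, R x y → Pre d e (s ^ d)⁻¹ x ∧ Pre d e (s ^ d)⁻¹ y ∧ Near v (s * x) (s * y))
    (hR' : ∀ x y, R x y → x ≠ 0 → y ≠ 0 → R (fa d e (s ^ d)⁻¹ x) (fa d e (s ^ d)⁻¹ y)) {x y : Λ}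
    (h : R x y) : x = y := by
  have key : ∀ n : ℕ, ∀ x y, R x y → v (s * x - s * y) ≤ (v s ^ (d - e - 1)) ^ n := by
    intro n
    induction n with
    | zero => intro x y h; simpa using (hR x y h).2.2.le
    | succ n ih =>
      intro x y h
      obtain ⟨h1, h2, h3⟩ := hR x y h
      by_cases hx : x = 0
      · by_cases hy : y = 0
        · simp [hx, hy]
        · have := h3.eq_one (pre_eq_one he hs hs1 h2 hy)
          simp [hx] at this
      by_cases hy : y = 0
      · have := h3.symm.eq_one (pre_eq_one he hs hs1 h1 hx)
        simp [hy] at this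
      rw [pre_diff he hs hs1 hd h1 h2 hx hy h3, pow_succ']
      gcongr
      exact ih _ _ (hR' x y h hx hy)
  have hlim : v (s * x - s * y) ≤ 0 := by
    have h3 : v s ^ (d - e - 1) < 1 := pow_lt_one₀ zero_le hs1 (by omega)
    exact ge_of_tendsto' (tendsto_pow_atTop_nhds_zero_of_lt_one zero_le h3)
      fun n => key n x y h
  have : s * x - s * y = 0 := by simpa using hlim
  exact mul_left_cancel₀ hs (sub_eq_zero.1 this)

end near

section code
variable {k Λ : Type*} [Field k] [Field Λ] [Algebra k Λ] (Z : Loc k Λ)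

lemma Loc.near_alg {c c' : k} (h : Near Z.v (algebraMap k Λ c) (algebraMap k Λ c')) : c = c' := by
  by_contra hne
  unfold Near at h
  rw [← map_sub, Z.hk _ (sub_ne_zero.2 hne)] at h
  exact lt_irrefl _ h

lemma Loc.alg_le (c : k) : Z.v (algebraMap k Λ c) ≤ 1 := by
  by_cases h : c = 0
  · simp [h]
  · exact (Z.hk c h).le

lemma Loc.natCast {d : ℕ} (hd : (d : k) ≠ 0) : Z.v (d : Λ) = 1 := by
  rw [← Z.hk _ hd]; simp

lemma Loc.code {d e : ℕ} {s : Λ} (he : e + 2 ≤ d) (hs : s ≠ 0) (hs1 : Z.v s < 1) {x : Λ}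
    (h : Pre d e (s ^ d)⁻¹ x) :
    ∃ c : k, (c = 0 ∨ c ^ d = 1) ∧ Near Z.v (s * x) (algebraMap k Λ c) := by
  by_cases hx : x = 0
  · exact ⟨0, Or.inl rfl, by simp [hx, Near]⟩
  · obtain ⟨c, hc⟩ := Z.hres _ (pre_le_one he hs hs1 h)
    refine ⟨c, Or.inr ?_, hc⟩
    have h1 : Near Z.v ((s * x) ^ d) (algebraMap k Λ c ^ d) := Near.pow hc (Z.alg_le c) d
    have h2 : Near Z.v ((s * x) ^ d) 1 := pre_near_one he hs hs1 h hx
    apply Z.near_alg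
    simpa using h1.symm.trans h2

/-- Frobenius rigidity -/
lemma Loc.frob {d e : ℕ} {s : Λ} (he : e + 2 ≤ d) (hs : s ≠ 0) (hs1 : Z.v s < 1)
    (hd : (d : k) ≠ 0) {q : ℕ} (hq : q ≠ 0) (hqd : q ≡ 1 [MOD d]) (fr : Λ →+* Λ)
    (hfr : ∀ x, fr x = x ^ q)
    (φ : Λ →ₐ[k] Λ) (hφ : φ s = s ^ q) (hφv : ∀ y, Z.v y < 1 → Z.v (φ y) < 1) {x : Λ}
    (h : Pre d e (s ^ d)⁻¹ x) : φ x = x ^ q := by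
  have e1 : φ.toRingHom ((s ^ d)⁻¹) = ((s ^ q) ^ d)⁻¹ := by simp [hφ]
  have e2 : fr ((s ^ d)⁻¹) = ((s ^ q) ^ d)⁻¹ := by simp [hfr, pow_right_comm]
  refine rigid (v := Z.v) (s := s ^ q) he (pow_ne_zero _ hs)
    (by rw [map_pow]; exact pow_lt_one₀ zero_le hs1 hq) (Z.natCast hd)
    (fun a b => ∃ x, Pre d e (s ^ d)⁻¹ x ∧ a = φ x ∧ b = x ^ q) ?_ ?_ ⟨x, h, rfl, rfl⟩
  · rintro _ _ ⟨x, h, rfl, rfl⟩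
    refine ⟨?_, ?_, ?_⟩
    · have := h.map φ.toRingHom he
      rwa [e1] at this
    · have := h.map fr he
      rwa [e2, hfr] at this
    · obtain ⟨c, hc, hn⟩ := Z.code he hs hs1 h
      have h1 : Near Z.v (s ^ q * φ x) (algebraMap k Λ c) := by
        have := hφv _ hn
        simpa [Near, hφ] using this
      have h2 : Near Z.v (s ^ q * x ^ q) (algebraMap k Λ c) := by
        have := hn.pow (Z.alg_le c) q
        rw [← map_pow, mul_pow] at this
        convert! this using 2
        rcases hc with rfl | hc
        · simp [hq]
        · rw [pow_eq_pow_mod q hc, hqd, ← pow_eq_pow_mod 1 hc, pow_one]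
      exact h1.trans h2.symm
  · rintro _ _ ⟨x, h, rfl, rfl⟩ hx _
    have hx0 : x ≠ 0 := by rintro rfl; simp at hx
    refine ⟨_, h.step hx0, ?_, ?_⟩
    · rw [← e1]; exact (fa_map φ.toRingHom).symm
    · rw [← e2, ← hfr, ← hfr, fa_map]
end code

end part2

section part3
open Polynomial
open scoped NNReal

section specval
variable (K Λ : Type*) [NontriviallyNormedField K] [CompleteSpace K] [IsUltrametricDist K]
  [Field Λ] [Algebra K Λ] [Algebra.IsAlgebraic K Λ]

noncomputable def specVal : Valuation Λ ℝ≥0 where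
  toFun y := ⟨spectralNorm K Λ y, spectralNorm_nonneg y⟩
  map_zero' := by ext; exact spectralNorm_zero
  map_one' := by ext; exact spectralNorm_one
  map_mul' x y := by
    exact Subtype.ext (map_mul (spectralMulAlgNorm K Λ) x y)
  map_add_le_max' x y := by
    have := isNonarchimedean_spectralNorm (K := K) (L := Λ) x y
    exact le_max_iff.2 ((le_max_iff.1 this).imp id id)

variable {K Λ}
lemma specVal_alg (a : K) : specVal K Λ (algebraMap K Λ a) = ‖a‖₊ := by
  ext; exact spectralNorm_extends a

lemma specVal_le_one {y : Λ} (h : specVal K Λ y ≤ 1) (n : ℕ) : ‖(minpoly K y).coeff n‖ ≤ 1 := by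
  have h1 : spectralValue (minpoly K y) ≤ 1 := by
    rw [← NNReal.coe_le_coe] at h; exact h
  exact (spectralValue_le_one_iff (minpoly.monic (Algebra.IsAlgebraic.isAlgebraic y).isIntegral)).1 h1 n

lemma specVal_lt_one {y : Λ} (h : specVal K Λ y < 1) (n : ℕ) (hn : n < (minpoly K y).natDegree) :
    ‖(minpoly K y).coeff n‖ < 1 := by
  have h1 : spectralValue (minpoly K y) < 1 := by
    rw [← NNReal.coe_lt_coe] at h; exact h
  have h2 := lt_of_le_of_lt (le_ciSup (spectralValueTerms_bddAbove (minpoly K y)) n) h1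
  rw [spectralValueTerms_of_lt_natDegree _ hn] at h2
  by_contra h3
  push Not at h3
  refine absurd h2 (not_lt.2 (Real.one_le_rpow h3 ?_))
  have : (n : ℝ) < (minpoly K y).natDegree := by exact_mod_cast hn
  have : 0 < ((minpoly K y).natDegree : ℝ) - n := by linarith
  positivity

lemma specVal_hres {k : Type*} [Field k] [IsAlgClosed k] [Algebra k K] [Algebra k Λ]
    [IsScalarTower k K Λ]
    (hres : ∀ y : K, ‖y‖ ≤ 1 → ∃ c : k, ‖y - algebraMap k K c‖ < 1) (y : Λ)
    (hy : specVal K Λ y ≤ 1) : ∃ c : k, specVal K Λ (y - algebraMap k Λ c) < 1 := by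
  have hm := minpoly.monic (Algebra.IsAlgebraic.isAlgebraic (R := K) y).isIntegral
  set P := minpoly K y with hP
  choose c hc using fun n => hres (P.coeff n) (specVal_le_one hy n)
  set n := P.natDegree with hn
  let P0 : k[X] := X ^ n + ∑ i ∈ Finset.range n, C (c i) * X ^ i
  have hdeg : (∑ i ∈ Finset.range n, C (c i) * X ^ i : k[X]).degree < (n : WithBot ℕ) := by
    rw [← mem_degreeLT]
    refine Submodule.sum_mem _ fun i hi => ?_
    rw [mem_degreeLT]
    refine lt_of_le_of_lt (degree_C_mul_X_pow_le _ _) ?_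
    exact_mod_cast Finset.mem_range.1 hi
  have hP0 : P0.Monic := monic_X_pow_add hdeg
  have hval : specVal K Λ (aeval y P0) < 1 := by
    have h0 : aeval y P = 0 := minpoly.aeval K y
    have h1 : aeval y P = y ^ n + ∑ i ∈ Finset.range n, algebraMap K Λ (P.coeff i) * y ^ i := by
      conv_lhs => rw [hm.as_sum]
      simp [hn]
    have h2 : aeval y P0 = -∑ i ∈ Finset.range n, algebraMap K Λ (P.coeff i - algebraMap k K (c i)) * y ^ i := by
      rw [h0] at h1
      simp only [P0, map_add, map_pow, aeval_X, map_sum, map_mul, aeval_C, map_sub, sub_mul,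
        Finset.sum_sub_distrib, ← IsScalarTower.algebraMap_apply]
      linear_combination -h1
    rw [h2, Valuation.map_neg]
    refine Valuation.map_sum_lt _ one_ne_zero fun i _ => ?_
    rw [map_mul, specVal_alg, map_pow]
    exact mul_lt_one_of_nonneg_of_lt_one_left zero_le (hc i) (pow_le_one₀ zero_le hy)
  have hs : P0.Splits := IsAlgClosed.splits P0
  have hprod := hs.eq_prod_roots_of_monic hP0
  rw [hprod, map_multiset_prod, map_multiset_prod] at hval
  by_contra hcon
  push Not at hcon
  refine absurd hval (not_lt.2 ?_)
  refine Multiset.one_le_prod ?_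
  intro x hx
  simp only [Multiset.map_map, Function.comp, Multiset.mem_map] at hx
  obtain ⟨a, -, rfl⟩ := hx
  simpa using hcon a

lemma specVal_phi (φ0 : K →+* K) (h0 : ∀ a, ‖a‖ < 1 → ‖φ0 a‖ < 1) (φ : Λ →+* Λ)
    (hφ : ∀ a, φ (algebraMap K Λ a) = algebraMap K Λ (φ0 a)) (y : Λ) (hy : specVal K Λ y < 1) :
    specVal K Λ (φ y) < 1 := by
  have hm := minpoly.monic (Algebra.IsAlgebraic.isAlgebraic (R := K) y).isIntegral
  have hl := specVal_lt_one hy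
  have hz : aeval y (minpoly K y) = 0 := minpoly.aeval K y
  set P := minpoly K y with hP
  rw [hm.as_sum] at hz
  simp only [map_add, map_pow, aeval_X, map_sum, map_mul, aeval_C] at hz
  have hz2 := congrArg φ hz
  simp only [map_add, map_pow, map_sum, map_mul, hφ, map_zero] at hz2
  by_contra hcon
  push Not at hcon
  have h3 : φ y ^ P.natDegree = - ∑ i ∈ Finset.range P.natDegree, algebraMap K Λ (φ0 (P.coeff i)) * φ y ^ i := by
    linear_combination hz2
  have h4 : specVal K Λ (φ y ^ P.natDegree) < (specVal K Λ (φ y)) ^ P.natDegree := by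
    conv_lhs => rw [h3]
    rw [Valuation.map_neg]
    refine Valuation.map_sum_lt _ (by positivity) fun i hi => ?_
    rw [Finset.mem_range] at hi
    rw [map_mul, map_pow, specVal_alg]
    refine lt_of_lt_of_le ?_ (pow_le_pow_right₀ hcon hi.le)
    exact mul_lt_of_lt_one_left (by positivity) (h0 _ (hl i hi))
  rw [map_pow] at h4
  exact lt_irrefl _ h4

end specval


lemma laurent_lt {k : Type} [Field k] (f : LaurentSeries k) :
    Valued.v f < (1 : WithZero (Multiplicative ℤ)) ↔ ∀ n < (1 : ℤ), f.coeff n = 0 := by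
  rw [← LaurentSeries.valuation_le_iff_coeff_lt_eq_zero, ← WithZero.lt_mul_exp_iff_le (by simp),
    ← WithZero.exp_add]
  simp

lemma laurent_le {k : Type} [Field k] (f : LaurentSeries k) :
    Valued.v f ≤ (1 : WithZero (Multiplicative ℤ)) ↔ ∀ n < (0 : ℤ), f.coeff n = 0 := by
  rw [← LaurentSeries.valuation_le_iff_coeff_lt_eq_zero]
  simp

lemma exists_extend {K A M : Type*} [Field K] [Field A] [Field M] [Algebra K A]
    [Algebra.IsAlgebraic K A] [IsAlgClosed M] (j : K →+* M) :
    ∃ φ : A →+* M, ∀ a, φ (algebraMap K A a) = j a := by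
  let := j.toAlgebra
  exact ⟨(IsAlgClosed.lift : A →ₐ[K] M), fun a => (IsAlgClosed.lift : A →ₐ[K] M).commutes a⟩

theorem exists_loc (k : Type) [Field k] [IsAlgClosed k] :
    ∃ (Λ : Type) (_ : Field Λ) (_ : IsAlgClosed Λ) (_ : Algebra k Λ) (Z : Loc k Λ) (s0 : Λ),
      s0 ≠ 0 ∧ Z.v s0 < 1 ∧ ∀ q : ℕ, q ≠ 0 → ∃ φ : Λ →ₐ[k] Λ, φ s0 = s0 ^ q ∧
        ∀ y, Z.v y < 1 → Z.v (φ y) < 1 := by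
  let K := LaurentSeries k
  have hX : Valued.v (HahnSeries.single (1 : ℤ) (1 : k) : K) < (1 : WithZero (Multiplicative ℤ)) := by
    rw [laurent_lt]
    intro n hn
    exact HahnSeries.coeff_single_of_ne hn.ne
  have hX0 : (HahnSeries.single (1 : ℤ) (1 : k) : K) ≠ 0 := by simp
  let hv : Valuation.RankOne (Valued.v : Valuation K (WithZero (Multiplicative ℤ))) :=
    { hom' := (WithZeroMulInt.toNNReal (e := 2) (by norm_num)).comp
        MonoidWithZeroHom.ValueGroup₀.embedding
      strictMono' := (WithZeroMulInt.toNNReal_strictMono (by norm_num)).comp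
        MonoidWithZeroHom.ValueGroup₀.embedding_strictMono
      exists_val_nontrivial := ⟨HahnSeries.single (1 : ℤ) (1 : k), (Valuation.ne_zero_iff _).2 hX0, hX.ne⟩ }
  let : NontriviallyNormedField K := Valued.toNontriviallyNormedField K (WithZero (Multiplicative ℤ))
  have : CompleteSpace K := LaurentSeries.instLaurentSeriesComplete
  have : IsUltrametricDist K := inferInstance
  let Λ := AlgebraicClosure K
  have hlt : ∀ f : K, ‖f‖ < 1 ↔ ∀ n < (1 : ℤ), f.coeff n = 0 := fun f => by
    rw [← laurent_lt]; exact Valued.toNormedField.norm_lt_one_iff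
  have hle : ∀ f : K, ‖f‖ ≤ 1 ↔ ∀ n < (0 : ℤ), f.coeff n = 0 := fun f => by
    rw [← laurent_le]; exact Valued.toNormedField.norm_le_one_iff
  have halg : ∀ c : k, algebraMap k K c = HahnSeries.C c := fun c => LaurentSeries.algebraMap_apply k c
  refine ⟨Λ, inferInstance, inferInstance, inferInstance, ⟨specVal K Λ, ?_, ?_⟩,
    algebraMap K Λ (HahnSeries.single (1 : ℤ) (1 : k)), ?_, ?_, ?_⟩
  · intro c hc
    rw [IsScalarTower.algebraMap_apply k K Λ, specVal_alg]
    have h1 : ‖algebraMap k K c‖ ≤ 1 := by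
      rw [hle, halg]; intro n hn; exact HahnSeries.coeff_single_of_ne hn.ne
    have h2 : ¬ ‖algebraMap k K c‖ < 1 := by
      rw [hlt, halg]; intro h; have := h 0 (by norm_num); simp at this; exact hc this
    ext; exact le_antisymm h1 (not_lt.1 h2)
  · refine specVal_hres ?_
    intro y hy
    rw [hle] at hy
    refine ⟨y.coeff 0, ?_⟩
    rw [hlt, halg]
    intro n hn
    rcases (by omega : n < 0 ∨ n = 0) with h | rfl
    · rw [HahnSeries.coeff_sub, hy n h, HahnSeries.C_apply, HahnSeries.coeff_single_of_ne h.ne]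
      simp
    · rw [HahnSeries.coeff_sub]; simp
  · exact (_root_.map_ne_zero _).2 hX0
  · rw [specVal_alg]
    exact (hlt _).2 ((laurent_lt _).1 hX)
  · intro q hq
    have hq' : 0 < (q : ℤ) := by omega
    let φ0 : K →+* K := HahnSeries.embDomainRingHom (AddMonoidHom.mulLeft (q : ℤ))
      (fun a b h => by simpa [hq] using h) (fun a b => mul_le_mul_iff_right₀ hq')
    let j : K →+* Λ := (algebraMap K Λ).comp φ0
    obtain ⟨φ1, hφ1⟩ := exists_extend (A := Λ) j
    have hφ0C : ∀ c : k, φ0 (algebraMap k K c) = algebraMap k K c := fun c => by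
      rw [halg]; exact HahnSeries.embDomainRingHom_C
    let φ : Λ →ₐ[k] Λ := { φ1 with
      commutes' := fun c => by
        show φ1 (algebraMap k Λ c) = algebraMap k Λ c
        rw [IsScalarTower.algebraMap_apply k K Λ, hφ1]
        show algebraMap K Λ (φ0 (algebraMap k K c)) = _
        rw [hφ0C] }
    refine ⟨φ, ?_, ?_⟩
    · show φ1 (algebraMap K Λ _) = _
      rw [hφ1, ← map_pow]
      show algebraMap K Λ (φ0 _) = _
      congr 1
      rw [HahnSeries.single_pow]
      refine (HahnSeries.embDomain_single).trans ?_
      simp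
    · refine specVal_phi φ0 ?_ (φ : Λ →+* Λ) hφ1
      intro a ha
      rw [hlt] at ha ⊢
      intro n hn
      by_cases h : ∃ m : ℤ, n = q * m
      · obtain ⟨m, rfl⟩ := h
        refine (HahnSeries.embDomain_coeff (a := m)).trans (ha m ?_)
        by_contra h
        push Not at h
        nlinarith
      · refine HahnSeries.embDomain_notin_range ?_
        rintro ⟨m, rfl⟩
        exact h ⟨m, rfl⟩

end part3

section part4
open Polynomial
open scoped NNReal IntermediateField

section biv
variable {k F : Type*} [Field k] [Field F] [Algebra k F]

lemma aa_eq (a b : F) (P : k[X][X]) :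
    aevalAeval a b P = eval₂ ((aeval a : k[X] →ₐ[k] F) : k[X] →+* F) b P := by
  induction P using Polynomial.induction_on' with
  | add p q hp hq => rw [map_add, eval₂_add, hp, hq]
  | monomial n p =>
    rw [eval₂_monomial, ← C_mul_X_pow_eq_monomial, map_mul, map_pow, aevalAeval_C, aevalAeval_Y]
    rfl

lemma coeff_swap' (P : k[X][X]) (i j : ℕ) :
    ((Bivariate.swap P).coeff i).coeff j = (P.coeff j).coeff i := by
  induction P using Polynomial.induction_on' with
  | add p q hp hq => simp [hp, hq]
  | monomial n p =>
    induction p using Polynomial.induction_on' with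
    | add p q hp hq => simp only [map_add, coeff_add, hp, hq]
    | monomial m r =>
      rw [Bivariate.swap_monomial_monomial]
      simp only [coeff_monomial]
      split_ifs <;> simp [coeff_monomial, *]

/-- degree of b over k(a) from irreducible bivariate relation -/
lemma minpoly_natDegree {a b : F} (ha : Transcendental k a) {P : k[X][X]} (hP : Irreducible P)
    (h0 : aevalAeval a b P = 0) : (minpoly k⟮a⟯ b).natDegree = P.natDegree := by
  have hdeg : P.natDegree ≠ 0 := by
    intro h
    rw [eq_C_of_natDegree_eq_zero h, aevalAeval_C] at h0
    have h1 := (transcendental_iff.1 ha) _ h0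
    rw [eq_C_of_natDegree_eq_zero h, h1] at hP
    simp at hP
  have hprim := hP.isPrimitive hdeg
  let g : k⟮a⟯ := IntermediateField.AdjoinSimple.gen k a
  let : Algebra k[X] k⟮a⟯ := ((aeval g : k[X] →ₐ[k] k⟮a⟯) : k[X] →+* k⟮a⟯).toAlgebra
  have hmap : ∀ p : k[X], algebraMap k⟮a⟯ F (algebraMap k[X] k⟮a⟯ p) = aeval a p := by
    intro p
    show algebraMap k⟮a⟯ F (aeval g p) = aeval a p
    rw [← aeval_algebraMap_apply]; rfl
  have hinj : Function.Injective (algebraMap k[X] k⟮a⟯) := by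
    rw [injective_iff_map_eq_zero]
    intro p hp
    have := hmap p
    rw [hp, map_zero] at this
    exact transcendental_iff.1 ha _ this.symm
  have : FaithfulSMul k[X] k⟮a⟯ := (faithfulSMul_iff_algebraMap_injective _ _).2 hinj
  have : IsFractionRing k[X] k⟮a⟯ := by
    refine IsFractionRing.of_field _ _ fun z => ?_
    obtain ⟨r, s, h⟩ := (IntermediateField.mem_adjoin_simple_iff k (z : F)).1 z.2
    refine ⟨r, s, ?_⟩
    apply (algebraMap k⟮a⟯ F).injective
    rw [map_div₀, hmap, hmap]; exact h
  have hirr := (hprim.irreducible_iff_irreducible_map_fraction_map (K := k⟮a⟯)).1 hP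
  have hz : aeval b (P.map (algebraMap k[X] k⟮a⟯)) = 0 := by
    rw [aeval_def, eval₂_map, ← h0, aa_eq]
    congr 1
    exact RingHom.ext hmap
  have := minpoly.eq_of_irreducible hirr hz
  rw [← this, natDegree_mul_C (by simp [hirr.ne_zero]), natDegree_map_eq_of_injective hinj]

/-- existence of an irreducible relation -/
lemma exists_irr {a b : F} (h : ∃ P : k[X][X], P ≠ 0 ∧ aevalAeval a b P = 0) :
    ∃ P : k[X][X], Irreducible P ∧ aevalAeval a b P = 0 := by
  classical
  obtain ⟨P, hP, h0⟩ := h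
  obtain ⟨u, hu⟩ := UniqueFactorizationMonoid.factors_prod hP
  rw [← hu, map_mul, mul_eq_zero] at h0
  have h1 : aevalAeval a b (UniqueFactorizationMonoid.factors P).prod = 0 := by
    rcases h0 with h | h
    · exact h
    · exact absurd h ((u.isUnit.map (aevalAeval a b)).ne_zero)
  rw [map_multiset_prod, Multiset.prod_eq_zero_iff, Multiset.mem_map] at h1
  obtain ⟨p, hp, hp0⟩ := h1
  exact ⟨p, UniqueFactorizationMonoid.irreducible_of_factor p hp, hp0⟩

lemma exists_rel {a b : F} (ha : Transcendental k a) (hb : IsAlgebraic k⟮a⟯ b) :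
    ∃ P : k[X][X], P ≠ 0 ∧ aevalAeval a b P = 0 := by
  let g : k⟮a⟯ := IntermediateField.AdjoinSimple.gen k a
  let : Algebra k[X] k⟮a⟯ := ((aeval g : k[X] →ₐ[k] k⟮a⟯) : k[X] →+* k⟮a⟯).toAlgebra
  have hmap : ∀ p : k[X], algebraMap k⟮a⟯ F (algebraMap k[X] k⟮a⟯ p) = aeval a p := by
    intro p
    show algebraMap k⟮a⟯ F (aeval g p) = aeval a p
    rw [← aeval_algebraMap_apply]; rfl
  have hinj : Function.Injective (algebraMap k[X] k⟮a⟯) := by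
    rw [injective_iff_map_eq_zero]
    intro p hp
    have := hmap p
    rw [hp, map_zero] at this
    exact transcendental_iff.1 ha _ this.symm
  have : FaithfulSMul k[X] k⟮a⟯ := (faithfulSMul_iff_algebraMap_injective _ _).2 hinj
  have : IsFractionRing k[X] k⟮a⟯ := by
    refine IsFractionRing.of_field _ _ fun z => ?_
    obtain ⟨r, s, h⟩ := (IntermediateField.mem_adjoin_simple_iff k (z : F)).1 z.2
    refine ⟨r, s, ?_⟩
    apply (algebraMap k⟮a⟯ F).injective
    rw [map_div₀, hmap, hmap]; exact h
  let : Algebra k[X] F := ((aeval a : k[X] →ₐ[k] F) : k[X] →+* F).toAlgebra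
  have : IsScalarTower k[X] k⟮a⟯ F := IsScalarTower.of_algebraMap_eq fun p => (hmap p).symm
  obtain ⟨p, hp, hp0⟩ := (IsFractionRing.isAlgebraic_iff k[X] k⟮a⟯ F).2 hb
  refine ⟨p, hp, ?_⟩
  rw [aa_eq]; exact hp0

lemma minpoly_mul_le {a b : F} (ha : Transcendental k a) (hb : Transcendental k b)
    (hab : Transcendental k (a * b)) (hba : IsAlgebraic k⟮a⟯ b) :
    (minpoly k⟮a * b⟯ a).natDegree ≤ (minpoly k⟮a⟯ b).natDegree + (minpoly k⟮b⟯ a).natDegree := by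
  obtain ⟨P, hP, h0⟩ := exists_irr (exists_rel ha hba)
  rw [minpoly_natDegree ha hP h0]
  have hP' : Irreducible (Bivariate.swap P) := (MulEquiv.irreducible_iff Bivariate.swap).2 hP
  rw [minpoly_natDegree hb hP' (by rw [Bivariate.aevalAeval_swap, h0])]
  set β := P.natDegree with hβ
  set α := (Bivariate.swap P).natDegree with hα
  have hc : ∀ i j, (P.coeff j).coeff i ≠ 0 → i ≤ α ∧ j ≤ β := by
    intro i j h
    refine ⟨?_, ?_⟩
    · by_contra hc
      rw [← coeff_swap', coeff_eq_zero_of_natDegree_lt (p := Bivariate.swap P) (by omega)] at h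
      simp at h
    · by_contra hc
      rw [coeff_eq_zero_of_natDegree_lt (p := P) (by omega)] at h
      simp at h
  let g : k⟮a * b⟯ := IntermediateField.AdjoinSimple.gen k (a * b)
  have hg : Transcendental k g := by
    rw [← transcendental_algebraMap_iff (A := F) (algebraMap k⟮a*b⟯ F).injective]
    exact hab
  let Q : k⟮a * b⟯[X] := ∑ j ∈ Finset.range (β + 1), ∑ i ∈ Finset.range (α + 1),
    monomial (i + (β - j)) ((P.coeff j).coeff i • g ^ j)
  have hQ0 : aeval a Q = 0 := by
    have hev : ∑ j ∈ Finset.range (β + 1), ∑ i ∈ Finset.range (α + 1),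
        (P.coeff j).coeff i • (a ^ i * b ^ j) = 0 := by
      rw [← h0, aa_eq, eval₂_eq_sum_range]
      refine Finset.sum_congr rfl fun j hj => ?_
      show _ = aeval a _ * _
      rw [aeval_eq_sum_range' (n := α + 1), Finset.sum_mul]
      · refine Finset.sum_congr rfl fun i _ => by rw [smul_mul_assoc]
      · rw [Nat.lt_succ_iff, natDegree_le_iff_coeff_eq_zero]
        intro N hN
        by_contra h
        have := (hc N j h).1
        omega
    have : aeval a Q = a ^ β * ∑ j ∈ Finset.range (β + 1), ∑ i ∈ Finset.range (α + 1),
        (P.coeff j).coeff i • (a ^ i * b ^ j) := by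
      simp only [Q, map_sum, Finset.mul_sum]
      refine Finset.sum_congr rfl fun j hj => Finset.sum_congr rfl fun i _ => ?_
      rw [aeval_monomial, Algebra.smul_def, map_mul, map_pow, Algebra.smul_def,
        ← IsScalarTower.algebraMap_apply]
      have h1 : algebraMap k⟮a*b⟯ F g = a * b := rfl
      have h2 : a ^ β = a ^ (β - j) * a ^ j := by
        rw [← pow_add]; congr 1; have := Finset.mem_range.1 hj; omega
      rw [h1, h2]; ring
    rw [this, hev, mul_zero]
  have hQ : Q ≠ 0 := by
    intro hQ
    obtain ⟨j0, hj0⟩ := not_forall.1 (fun h : ∀ j, P.coeff j = 0 => hP.ne_zero (ext (by simpa using h)))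
    obtain ⟨i0, hi0⟩ := not_forall.1 (fun h : ∀ i, (P.coeff j0).coeff i = 0 => hj0 (ext (by simpa using h)))
    obtain ⟨hi, hj⟩ := hc _ _ hi0
    have h1 := congrArg (fun q => q.coeff (i0 + (β - j0))) hQ
    simp only [Q, finsetSum_coeff, coeff_monomial, coeff_zero] at h1
    have h2 : aeval g (∑ j ∈ Finset.range (β + 1), ∑ i ∈ Finset.range (α + 1),
        if i + (β - j) = i0 + (β - j0) then monomial j ((P.coeff j).coeff i) else 0) = 0 := by
      rw [← h1]
      simp only [map_sum]
      refine Finset.sum_congr rfl fun j _ => Finset.sum_congr rfl fun i _ => ?_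
      split_ifs
      · rw [aeval_monomial, Algebra.smul_def]
      · simp
    have h3 := congrArg (fun q => q.coeff j0) (transcendental_iff.1 hg _ h2)
    simp only [finsetSum_coeff, coeff_zero] at h3
    rw [Finset.sum_eq_single j0, Finset.sum_eq_single i0] at h3
    · simp at h3; exact hi0 h3
    · intro i _ hne
      rw [if_neg (by omega)]; simp
    · intro h; simp at h; omega
    · intro j _ hne
      refine Finset.sum_eq_zero fun i _ => ?_
      split_ifs
      · rw [coeff_monomial, if_neg hne]
      · simp
    · intro h; simp at h; omega
  refine (natDegree_le_natDegree (minpoly.degree_le_of_ne_zero k⟮a*b⟯ a hQ hQ0)).trans ?_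
  refine natDegree_sum_le_of_forall_le _ _ fun j hj => natDegree_sum_le_of_forall_le _ _ fun i hi => ?_
  refine (natDegree_monomial_le _).trans ?_
  simp at hi hj
  omega
end biv

end part4

section part5
open Polynomial
open scoped NNReal IntermediateField

section dgs
variable {k F : Type*} [Field k] [Field F] [Algebra k F]

variable (k) in
noncomputable def dg (a : F) : ℕ := (k⟮a⟯).relfinrank ⊤

lemma dg_eq (a : F) : dg k a = Module.finrank k⟮a⟯ F := IntermediateField.relfinrank_top_right _

lemma dg_map {A : Type*} [Field A] [Algebra k A] (ψ : A →ₐ[k] F) (a : A) :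
    dg k (ψ a) = dg k a * Module.finrank ψ.fieldRange F := by
  have h : k⟮ψ a⟯ = (k⟮a⟯).map ψ := by
    rw [IntermediateField.adjoin_map]; simp
  have h2 : (⊤ : IntermediateField k A).map ψ = ψ.fieldRange := by
    rw [AlgHom.fieldRange_eq_map]
  unfold dg
  rw [h, ← IntermediateField.relfinrank_mul_relfinrank (B := ψ.fieldRange) _ le_top,
    IntermediateField.relfinrank_top_right, ← h2, IntermediateField.relfinrank_map_map]
  rw [← h2]; exact IntermediateField.map_mono _ le_top

lemma relfinrank_pair {a b : F} (h : IsIntegral k⟮a⟯ b) :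
    (k⟮a⟯).relfinrank (IntermediateField.adjoin k {a, b}) = (minpoly k⟮a⟯ b).natDegree := by
  rw [← IntermediateField.adjoin.finrank h, ← IntermediateField.adjoin_simple_adjoin_simple]
  have hle : k⟮a⟯ ≤ IntermediateField.restrictScalars k (k⟮a⟯)⟮b⟯ := by
    intro x hx
    exact (k⟮a⟯⟮b⟯).algebraMap_mem ⟨x, hx⟩
  rw [IntermediateField.relfinrank_eq_finrank_of_le hle]
  congr 1

lemma dg_pair {a b : F} (h : IsIntegral k⟮a⟯ b) :
    dg k a = (minpoly k⟮a⟯ b).natDegree * (IntermediateField.adjoin k {a, b}).relfinrank ⊤ := by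
  rw [← relfinrank_pair h, dg, IntermediateField.relfinrank_mul_relfinrank _ le_top]
  exact IntermediateField.adjoin.mono _ _ _ (by simp)

variable (k F) in
def FFld : Prop := (∃ t : F, Transcendental k t) ∧ ∀ a : F, Transcendental k a → FiniteDimensional k⟮a⟯ F

lemma dg_pos (hF : FFld k F) {a : F} (ha : Transcendental k a) : 0 < dg k a := by
  have := hF.2 a ha
  rw [dg_eq]; exact Module.finrank_pos

lemma dg_algebraic (hF : FFld k F) {a : F} (ha : IsAlgebraic k a) : dg k a = 0 := by
  by_contra h
  rw [dg_eq] at h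
  have := Module.finite_of_finrank_pos (Nat.pos_of_ne_zero h)
  obtain ⟨t, ht⟩ := hF.1
  have h1 : FiniteDimensional k k⟮a⟯ := IntermediateField.adjoin.finiteDimensional ha.isIntegral
  have := FiniteDimensional.trans k k⟮a⟯ F
  exact ht (Algebra.IsAlgebraic.isAlgebraic t)

lemma dg_congr {a b : F} (h : k⟮a⟯ = k⟮b⟯) : dg k a = dg k b := by unfold dg; rw [h]

lemma dg_inv (a : F) : dg k a⁻¹ = dg k a := by
  apply dg_congr
  apply le_antisymm
  · rw [IntermediateField.adjoin_simple_le_iff]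
    exact inv_mem (IntermediateField.mem_adjoin_simple_self k a)
  · rw [IntermediateField.adjoin_simple_le_iff]
    have := inv_mem (IntermediateField.mem_adjoin_simple_self k a⁻¹)
    rwa [inv_inv] at this

lemma dg_sub_alg (a : F) (c : k) : dg k (a - algebraMap k F c) = dg k a := by
  apply dg_congr
  apply le_antisymm
  · rw [IntermediateField.adjoin_simple_le_iff]
    exact sub_mem (IntermediateField.mem_adjoin_simple_self k a) (IntermediateField.algebraMap_mem _ c)
  · rw [IntermediateField.adjoin_simple_le_iff]
    have := add_mem (IntermediateField.mem_adjoin_simple_self k (a - algebraMap k F c))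
      (IntermediateField.algebraMap_mem _ c)
    rwa [sub_add_cancel] at this

lemma dg_alg_mul (a : F) {c : k} (hc : c ≠ 0) : dg k (algebraMap k F c * a) = dg k a := by
  apply dg_congr
  apply le_antisymm
  · rw [IntermediateField.adjoin_simple_le_iff]
    exact mul_mem (IntermediateField.algebraMap_mem _ c) (IntermediateField.mem_adjoin_simple_self k a)
  · rw [IntermediateField.adjoin_simple_le_iff]
    have := mul_mem (IntermediateField.algebraMap_mem _ c⁻¹)
      (IntermediateField.mem_adjoin_simple_self k (algebraMap k F c * a))
    rwa [← mul_assoc, ← map_mul, inv_mul_cancel₀ hc, map_one, one_mul] at this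

lemma alg_mem [IsAlgClosed k] {a : F} (ha : IsAlgebraic k a) : ∃ c : k, algebraMap k F c = a := by
  have h1 : FiniteDimensional k k⟮a⟯ := IntermediateField.adjoin.finiteDimensional ha.isIntegral
  obtain ⟨c, hc⟩ := (IsAlgClosed.algebraMap_bijective_of_isIntegral (k := k) (K := k⟮a⟯)).2
    ⟨a, IntermediateField.mem_adjoin_simple_self k a⟩
  exact ⟨c, congrArg Subtype.val hc⟩

lemma dg_mul_le [IsAlgClosed k] (hF : FFld k F) (a b : F) : dg k (a * b) ≤ dg k a + dg k b := by
  by_cases ha : IsAlgebraic k a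
  · obtain ⟨c, rfl⟩ := alg_mem ha
    by_cases hc : c = 0
    · subst hc; rw [map_zero, zero_mul]; omega
    · rw [dg_alg_mul b hc]; omega
  by_cases hb : IsAlgebraic k b
  · obtain ⟨c, rfl⟩ := alg_mem hb
    by_cases hc : c = 0
    · subst hc; rw [map_zero, mul_zero]; omega
    · rw [mul_comm, dg_alg_mul a hc]; omega
  by_cases hab : IsAlgebraic k (a * b)
  · rw [dg_algebraic hF hab]; omega
  have h1 := hF.2 a ha
  have h2 := hF.2 b hb
  have h3 := hF.2 _ hab
  have ha0 : a ≠ 0 := by rintro rfl; exact ha isAlgebraic_zero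
  rw [dg_pair (a := a) (b := b) (Algebra.IsIntegral.isIntegral b),
    dg_pair (a := b) (b := a) (Algebra.IsIntegral.isIntegral a),
    dg_pair (a := a * b) (b := a) (Algebra.IsIntegral.isIntegral a), Set.pair_comm b a]
  have h4 : IntermediateField.adjoin k {a * b, a} = IntermediateField.adjoin k {a, b} := by
    apply le_antisymm
    · rw [IntermediateField.adjoin_le_iff]
      have h5 : a ∈ IntermediateField.adjoin k {a, b} := IntermediateField.subset_adjoin _ _ (by simp)
      have h6 : b ∈ IntermediateField.adjoin k {a, b} := IntermediateField.subset_adjoin _ _ (by simp)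
      rintro x (rfl | rfl)
      · exact mul_mem h5 h6
      · exact h5
    · rw [IntermediateField.adjoin_le_iff]
      have h5 : a ∈ IntermediateField.adjoin k {a * b, a} := IntermediateField.subset_adjoin _ _ (by simp)
      have h6 : a * b ∈ IntermediateField.adjoin k {a * b, a} := IntermediateField.subset_adjoin _ _ (by simp)
      rintro x (rfl | rfl)
      · exact h5
      · have := mul_mem (inv_mem h5) h6
        rwa [inv_mul_cancel_left₀ ha0] at this
  rw [h4, ← add_mul]
  exact Nat.mul_le_mul_right _ (minpoly_mul_le ha hb hab (Algebra.IsAlgebraic.isAlgebraic b))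

lemma dg_prod_le [IsAlgClosed k] (hF : FFld k F) (m : Multiset F) (n : ℕ)
    (h : ∀ a ∈ m, dg k a ≤ n) : dg k m.prod ≤ m.card * n := by
  induction m using Multiset.induction_on with
  | empty => simp [dg_algebraic hF isAlgebraic_one]
  | cons a m ih =>
    rw [Multiset.prod_cons, Multiset.card_cons]
    have h1 := dg_mul_le hF a m.prod
    have h2 := h a (by simp)
    have h3 := ih fun b hb => h b (by simp [hb])
    nlinarith

lemma alg_swap {a t : F} (ha : Transcendental k a) (ht : Transcendental k t)
    (h : IsAlgebraic k⟮t⟯ a) : IsAlgebraic k⟮a⟯ t := by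
  obtain ⟨P, hP, h0⟩ := exists_irr (exists_rel ht h)
  have hP' : Irreducible (Bivariate.swap P) := (MulEquiv.irreducible_iff Bivariate.swap).2 hP
  have h0' : aevalAeval a t (Bivariate.swap P) = 0 := by rw [Bivariate.aevalAeval_swap, h0]
  have h1 := minpoly_natDegree ha hP' h0'
  by_contra hcon
  have h2 : minpoly k⟮a⟯ t = 0 := minpoly.eq_zero fun hi => hcon hi.isAlgebraic
  rw [h2, natDegree_zero, eq_comm] at h1
  rw [eq_C_of_natDegree_eq_zero h1, aevalAeval_C] at h0'
  have h3 := (transcendental_iff.1 ha) _ h0'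
  rw [eq_C_of_natDegree_eq_zero h1, h3] at hP'
  simp at hP'

lemma FFld.of {t : F} (ht : Transcendental k t) (hf : FiniteDimensional k⟮t⟯ F) : FFld k F := by
  refine ⟨⟨t, ht⟩, fun a ha => ?_⟩
  have h1 := alg_swap ha ht (Algebra.IsAlgebraic.isAlgebraic a)
  have h2 := dg_pair h1.isIntegral
  have h3 := relfinrank_pair (k := k) (a := t) (b := a) (Algebra.IsIntegral.isIntegral a)
  have h4 := dg_pair (k := k) (a := t) (b := a) (Algebra.IsIntegral.isIntegral a)
  have h5 : 0 < dg k t := by rw [dg_eq]; exact Module.finrank_pos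
  have h6 : 0 < dg k a := by
    rw [h2, Set.pair_comm]
    refine Nat.mul_pos (minpoly.natDegree_pos h1.isIntegral) ?_
    rw [h4] at h5
    exact Nat.pos_of_mul_pos_left h5
  rw [dg_eq] at h6
  exact Module.finite_of_finrank_pos h6

lemma dg_tower {A : Type*} [Field A] [Algebra k A] [Algebra A F] [IsScalarTower k A F] (a : A) :
    dg k (algebraMap A F a) = dg k a * Module.finrank A F := by
  have := dg_map (IsScalarTower.toAlgHom k A F) a
  rw [IsScalarTower.toAlgHom_apply] at this
  rw [this]
  congr 1
  symm
  refine Algebra.finrank_eq_of_equiv_equiv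
    (AlgEquiv.ofInjectiveField (IsScalarTower.toAlgHom k A F)).toRingEquiv (RingEquiv.refl F) ?_
  ext x; rfl
end dgs

end part5

section part6
open Polynomial
open scoped NNReal IntermediateField

section lemG
variable {k M F R : Type*} [Field k] [Field M] [Field F] [Field R] [Algebra k M] [Algebra k F]
  [Algebra k R] [Algebra M F] [Algebra M R] [Algebra F R] [IsScalarTower k M F] [IsScalarTower k F R]
  [IsScalarTower k M R] [IsScalarTower M F R]

lemma FFld.up [FiniteDimensional M F] (h : FFld k M) : FFld k F := by
  obtain ⟨t, ht⟩ := h.1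
  have ht' : Transcendental k (algebraMap M F t) := fun h =>
    ht ((isAlgebraic_algebraMap_iff (algebraMap M F).injective).1 h)
  refine FFld.of ht' ?_
  have h1 := dg_tower (k := k) (F := F) t
  have h2 := Nat.mul_pos (dg_pos h ht) (Module.finrank_pos (R := M) (M := F))
  rw [← h1, dg_eq] at h2
  exact Module.finite_of_finrank_pos h2

lemma FFld.down (h : FFld k F) {t : M} (ht : Transcendental k t) : FFld k M := by
  refine FFld.of ht ?_
  have ht' : Transcendental k (algebraMap M F t) := fun h =>
    ht ((isAlgebraic_algebraMap_iff (algebraMap M F).injective).1 h)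
  have h1 := dg_tower (k := k) (F := F) t
  have h2 := dg_pos h ht'
  rw [h1] at h2
  have h3 := Nat.pos_of_mul_pos_right h2
  rw [dg_eq] at h3
  exact Module.finite_of_finrank_pos h3

lemma exists_eval_transc [IsAlgClosed k] (f : M[X]) (T : F) (hT : Transcendental k T) (hf : f.Monic)
    (h0 : aeval T f = 0) : ∃ c : k, Transcendental k (f.eval (algebraMap k M c)) := by
  classical
  by_contra hcon
  push Not at hcon
  have hcon' : ∀ c : k, ∃ b : k, algebraMap k M b = f.eval (algebraMap k M c) := fun c =>
    alg_mem (by simpa [Transcendental] using hcon c)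
  choose b hb using hcon'
  have hinf : Infinite k := IsAlgClosed.instInfinite
  obtain ⟨S, hS⟩ := Infinite.exists_subset_card_eq k (f.natDegree + 1)
  let g : k[X] := Lagrange.interpolate S id b
  have hg : g.map (algebraMap k M) = f := by
    have hinj : Set.InjOn (algebraMap k M) S := (algebraMap k M).injective.injOn
    refine Polynomial.eq_of_degrees_lt_of_eval_index_eq S hinj ?_ ?_ ?_
    · rw [degree_map]
      exact Lagrange.degree_interpolate_lt _ (Function.injective_id.injOn)
    · rw [hS]
      exact lt_of_le_of_lt degree_le_natDegree (by exact_mod_cast Nat.lt_succ_self _)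
    · intro i hi
      rw [eval_map_algebraMap, aeval_algebraMap_apply, ← hb i]
      congr 1
      exact Lagrange.eval_interpolate_at_node b (Function.injective_id.injOn) hi
  apply hT
  refine ⟨g, ?_, ?_⟩
  · rintro h; rw [h, Polynomial.map_zero] at hg; exact hf.ne_zero hg.symm
  · rw [← hg, aeval_map_algebraMap] at h0; exact h0

lemma lemG_aux [IsAlgClosed k] [FiniteDimensional M F] [FiniteDimensional F R] [Normal M R]
    (hF : FFld k F) {T : F} (hT : Transcendental k T) :
    ∃ t : M, Transcendental k t ∧ dg k t ≤ dg k T := by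
  obtain ⟨c, hc⟩ := exists_eval_transc (k := k) (minpoly M T) T hT
    (minpoly.monic (Algebra.IsIntegral.isIntegral T)) (minpoly.aeval _ _)
  refine ⟨_, hc, ?_⟩
  have hR : FFld k R := FFld.up (M := F) hF
  have hfin : FiniteDimensional M R := FiniteDimensional.trans M F R
  set f := minpoly M T with hf
  have hf' : f = minpoly M (algebraMap F R T) := (minpoly.algebraMap_eq (algebraMap F R).injective T).symm
  have hsp : (f.map (algebraMap M R)).Splits := by rw [hf']; exact Normal.splits inferInstance _
  have hmon : f.Monic := minpoly.monic (Algebra.IsIntegral.isIntegral T)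
  have hprod : algebraMap M R (f.eval (algebraMap k M c)) =
      ((f.map (algebraMap M R)).roots.map (fun r => algebraMap k R c - r)).prod := by
    have := hsp.eval_eq_prod_roots_of_monic (hmon.map _) (algebraMap k R c)
    rw [← this, IsScalarTower.algebraMap_apply k M R, eval_map_algebraMap, aeval_algebraMap_apply]
    simp
  have hle := dg_prod_le hR ((f.map (algebraMap M R)).roots.map (fun r => algebraMap k R c - r))
    (dg k (algebraMap F R T)) (by
      intro a ha
      rw [Multiset.mem_map] at ha
      obtain ⟨r, hr, rfl⟩ := ha
      have h1 : dg k (algebraMap k R c - r) = dg k r := by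
        rw [← dg_sub_alg r c]
        by_cases hneg : True
        · apply dg_congr
          rw [← neg_sub]
          apply le_antisymm
          · rw [IntermediateField.adjoin_simple_le_iff]
            exact neg_mem (IntermediateField.mem_adjoin_simple_self k _)
          · rw [IntermediateField.adjoin_simple_le_iff]
            have := neg_mem (IntermediateField.mem_adjoin_simple_self k (-(r - algebraMap k R c)))
            rwa [neg_neg] at this
        · exact absurd trivial hneg
      rw [h1]
      have h2 : IsConjRoot M (algebraMap F R T) r := by
        rw [isConjRoot_iff_aeval_eq_zero (Algebra.IsIntegral.isIntegral _), ← hf']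
        rw [mem_roots (hmon.map _).ne_zero, IsRoot.def, eval_map_algebraMap] at hr
        exact hr
      obtain ⟨τ, hτ⟩ := h2.exists_algEquiv
      have h3 := dg_map (k := k) ((τ : R →ₐ[M] R).restrictScalars k) r
      have h4 : ((τ : R →ₐ[M] R).restrictScalars k).fieldRange = ⊤ := by
        rw [AlgHom.fieldRange_eq_top]
        exact τ.surjective
      rw [h4, IntermediateField.finrank_top, mul_one] at h3
      rw [← h3]
      apply le_of_eq
      congr 1)
  rw [← hprod, Multiset.card_map, dg_tower, dg_tower,
    ← Module.finrank_mul_finrank M F R] at hle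
  have hcard : (f.map (algebraMap M R)).roots.card ≤ Module.finrank M F := by
    refine (card_roots' _).trans ?_
    rw [natDegree_map]; exact minpoly.natDegree_le T
  have h5 : 0 < Module.finrank M F := Module.finrank_pos
  have h6 : 0 < Module.finrank F R := Module.finrank_pos
  refine Nat.le_of_mul_le_mul_right (c := Module.finrank M F * Module.finrank F R) ?_ (Nat.mul_pos h5 h6)
  refine hle.trans ?_
  calc _ ≤ Module.finrank M F * (dg k T * Module.finrank F R) := Nat.mul_le_mul_right _ hcard
    _ = _ := by ring
end lemG

lemma lemG {k M F : Type*} [Field k] [Field M] [Field F] [Algebra k M] [Algebra k F]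
    [Algebra M F] [IsScalarTower k M F] [IsAlgClosed k] [FiniteDimensional M F]
    (hF : FFld k F) {T : F} (hT : Transcendental k T) :
    ∃ t : M, Transcendental k t ∧ dg k t ≤ dg k T := by
  let R := IntermediateField.normalClosure M F (AlgebraicClosure F)
  have h1 : FiniteDimensional M R := inferInstance
  have h2 : FiniteDimensional F R := FiniteDimensional.right M F R
  have h3 : IsScalarTower k F R := IsScalarTower.of_algebraMap_eq fun x => by
    apply Subtype.ext; rfl
  exact lemG_aux (R := R) hF hT

end part6

section part7
open Polynomial
open scoped NNReal IntermediateField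

section indep
variable {k M Λ : Type*} [Field k] [Field M] [Field Λ] [Algebra k M] [Algebra k Λ] (Z : Loc k Λ)

lemma Loc.near_aeval (P : k[X]) {a : Λ} (h : Z.v a < 1) :
    Near Z.v (aeval a P) (algebraMap k Λ (P.coeff 0)) := by
  rw [coeff_zero_eq_aeval_zero' (A := Λ), aeval_eq_sum_range, aeval_eq_sum_range]
  refine Near.sum _ fun i _ => ?_
  rw [Algebra.smul_def, Algebra.smul_def]
  refine Near.mul (Near.refl _) (Near.pow (by simpa [Near] using h) (by simp) i) (Z.alg_le _) ?_
  rw [map_pow]; exact pow_le_one₀ zero_le (by simp)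

lemma indep_aux (J : Finset (M →ₐ[k] Λ)) (u : M) (hu0 : u ≠ 0) (hu : ∀ ρ ∈ J, Z.v (ρ u) < 1)
    (ε : (M →ₐ[k] Λ) → M) (h1 : ∀ ρ ∈ J, Z.v (ρ (ε ρ)) = 1)
    (h2 : ∀ ρ ∈ J, ∀ ρ' ∈ J, ρ ≠ ρ' → Z.v (ρ (ε ρ')) < 1) (N : ℕ) :
    ∀ P : (M →ₐ[k] Λ) → k[X], (∀ ρ ∈ J, (P ρ).degree < N) →
      ∑ ρ ∈ J, aeval u (P ρ) * ε ρ = 0 → ∀ ρ ∈ J, P ρ = 0 := by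
  classical
  induction N with
  | zero =>
    intro P hP _ ρ hρ
    have := hP ρ hρ
    rw [Nat.cast_zero] at this
    by_contra h
    rw [degree_eq_natDegree h] at this
    exact absurd this (by exact_mod_cast Nat.not_lt_zero _)
  | succ N ih =>
    intro P hP hsum
    have hc : ∀ ρ ∈ J, (P ρ).coeff 0 = 0 := by
      intro ρ hρ
      have h3 := congrArg ρ hsum
      rw [map_sum, map_zero, ← Finset.add_sum_erase _ _ hρ, map_mul] at h3
      have h4 : Z.v (∑ x ∈ J.erase ρ, ρ (aeval u (P x) * ε x)) < 1 := by
        refine Valuation.map_sum_lt Z.v one_ne_zero fun ρ' hρ' => ?_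
        rw [Finset.mem_erase] at hρ'
        rw [map_mul, map_mul, ← aeval_algHom_apply]
        exact mul_lt_one_of_nonneg_of_lt_one_right
          ((Z.near_aeval _ (hu ρ hρ)).le_one (Z.alg_le _)) zero_le (h2 ρ hρ ρ' hρ'.2 hρ'.1.symm)
      rw [← neg_eq_iff_add_eq_zero] at h3
      rw [← h3, Valuation.map_neg, map_mul, h1 ρ hρ, mul_one, ← aeval_algHom_apply] at h4
      have h5 := Z.near_aeval (P ρ) (hu ρ hρ)
      by_contra h6
      rw [h5.eq_one (Z.hk _ h6)] at h4
      exact lt_irrefl _ h4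
    have hX : ∀ ρ ∈ J, P ρ = X * (P ρ).divX := by
      intro ρ hρ
      conv_lhs => rw [← X_mul_divX_add (P ρ), hc ρ hρ, C_0, add_zero]
    have h7 := ih (fun ρ => (P ρ).divX) (by
      intro ρ hρ
      by_cases h0 : P ρ = 0
      · simp [h0]
      · have := degree_divX_lt h0
        have h8 := hP ρ hρ
        rw [degree_eq_natDegree h0] at h8 this
        by_cases h9 : (P ρ).divX = 0
        · simp [h9]
        · rw [degree_eq_natDegree h9] at this ⊢
          norm_cast at this h8 ⊢
          omega) (by
      have : u * ∑ ρ ∈ J, aeval u ((P ρ).divX) * ε ρ = 0 := by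
        rw [Finset.mul_sum, ← hsum]
        refine Finset.sum_congr rfl fun ρ hρ => ?_
        conv_rhs => rw [hX ρ hρ, map_mul, aeval_X]
        ring
      exact (mul_eq_zero.1 this).resolve_left hu0)
    intro ρ hρ
    rw [hX ρ hρ, h7 ρ hρ, mul_zero]

open scoped IntermediateField.algebraAdjoinAdjoin in
lemma card_le_dg (J : Finset (M →ₐ[k] Λ)) (u : M) (hu0 : Transcendental k u)
    (hF : FiniteDimensional k⟮u⟯ M) (hu : ∀ ρ ∈ J, Z.v (ρ u) < 1)
    (ε : (M →ₐ[k] Λ) → M) (h1 : ∀ ρ ∈ J, Z.v (ρ (ε ρ)) = 1)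
    (h2 : ∀ ρ ∈ J, ∀ ρ' ∈ J, ρ ≠ ρ' → Z.v (ρ (ε ρ')) < 1) : J.card ≤ dg k u := by
  classical
  have hli : LinearIndependent (Algebra.adjoin k {u}) (fun ρ : J => ε ρ) := by
    rw [Fintype.linearIndependent_iff]
    intro g hg
    have hg' : ∀ ρ : J, ∃ P : k[X], aeval u P = (g ρ : M) := fun ρ => by
      exact (le_of_eq (Algebra.adjoin_singleton_eq_range_aeval k u)) (g ρ).2
    choose P hP using hg'
    let P' : (M →ₐ[k] Λ) → k[X] := fun ρ => if h : ρ ∈ J then P ⟨ρ, h⟩ else 0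
    have hP' : ∀ ρ : J, P' ρ = P ρ := fun ρ => by simp [P']
    have h0 : u ≠ 0 := by rintro rfl; exact hu0 isAlgebraic_zero
    have key := indep_aux Z J u h0 hu ε h1 h2 (∑ ρ ∈ J, ((P' ρ).natDegree + 1)) P' (by
      intro ρ hρ
      refine lt_of_le_of_lt degree_le_natDegree ?_
      norm_cast
      exact lt_of_lt_of_le (Nat.lt_succ_self _)
        (Finset.single_le_sum (f := fun ρ => (P' ρ).natDegree + 1) (fun _ _ => Nat.zero_le _) hρ)) (by
      rw [← Finset.sum_coe_sort, ← hg]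
      refine Finset.sum_congr rfl fun ρ _ => ?_
      rw [hP', hP]; rfl)
    intro ρ
    apply Subtype.ext
    rw [← hP ρ, ← hP' ρ, key ρ ρ.2]; simp
  have hli' : LinearIndependent k⟮u⟯ (fun ρ : J => ε ρ) :=
    (LinearIndependent.iff_fractionRing (Algebra.adjoin k {u}) k⟮u⟯).1 hli
  have := hli'.fintype_card_le_finrank
  rwa [Fintype.card_coe, ← dg_eq] at this
end indep

end part7

section part8
open Polynomial
open scoped NNReal IntermediateField

section sepa
variable {k M Λ : Type*} [Field k] [Field M] [Field Λ] [Algebra k M] [Algebra k Λ] (Z : Loc k Λ)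
  {s0 : Λ} (hs0 : s0 ≠ 0) (hs1 : Z.v s0 < 1) {d e : ℕ} (he : e + 2 ≤ d) (hd : (d : k) ≠ 0)
  {s : M} {Q : Set M} (hQ : ∀ x ∈ Q, Pre d e (s ^ d)⁻¹ x)
  (hgen : IntermediateField.adjoin k (insert s Q) = ⊤)
include hgen in
lemma hom_ext_gen {A : Type*} [Field A] [Algebra k A] {ρ ρ' : M →ₐ[k] A} (hs : ρ s = ρ' s)
    (h : ∀ x ∈ Q, ρ x = ρ' x) : ρ = ρ' := by
  ext x
  have hx : x ∈ IntermediateField.adjoin k (insert s Q) := by rw [hgen]; trivial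
  induction hx using IntermediateField.adjoin_induction with
  | mem x hx =>
    rcases hx with rfl | hx
    · exact hs
    · exact h x hx
  | algebraMap c => simp
  | add x y _ _ h1 h2 => simp [h1, h2]
  | inv x _ h1 => simp [h1]
  | mul x y _ _ h1 h2 => simp [h1, h2]

include he in
lemma pre_emb {ρ : M →ₐ[k] Λ} (hρ : ρ s = s0) {y : M} (h : Pre d e (s ^ d)⁻¹ y) :
    Pre d e (s0 ^ d)⁻¹ (ρ y) := by
  have := h.map (ρ : M →+* Λ) he
  simpa [hρ] using this

include hs0 hs1 he hd hQ hgen in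
lemma sep {ρ ρ' : M →ₐ[k] Λ} (hρ : ρ s = s0) (hρ' : ρ' s = s0) (hne : ρ ≠ ρ') :
    ∃ f : M, Z.v (ρ f) = 1 ∧ Z.v (ρ' f) < 1 ∧ ∀ τ : M →ₐ[k] Λ, τ s = s0 → Z.v (τ f) ≤ 1 := by
  have key : ∃ y : M, Pre d e (s ^ d)⁻¹ y ∧ ¬ Near Z.v (s0 * ρ y) (s0 * ρ' y) := by
    by_contra hcon
    push Not at hcon
    apply hne
    refine hom_ext_gen hgen (hρ.trans hρ'.symm) fun x hx => ?_
    refine rigid he hs0 hs1 (Z.natCast hd)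
      (fun a b => ∃ y : M, Pre d e (s ^ d)⁻¹ y ∧ ρ y = a ∧ ρ' y = b) ?_ ?_ ⟨x, hQ x hx, rfl, rfl⟩
    · rintro _ _ ⟨y, hy, rfl, rfl⟩
      exact ⟨pre_emb he hρ hy, pre_emb he hρ' hy, hcon y hy⟩
    · rintro _ _ ⟨y, hy, rfl, rfl⟩ h0 _
      have hy0 : y ≠ 0 := by rintro rfl; simp at h0
      refine ⟨_, hy.step hy0, ?_, ?_⟩
      · have := fa_map (d := d) (e := e) (σ := (s ^ d)⁻¹) (x := y) (ρ : M →+* Λ)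
        simpa [hρ] using this
      · have := fa_map (d := d) (e := e) (σ := (s ^ d)⁻¹) (x := y) (ρ' : M →+* Λ)
        simpa [hρ'] using this
  obtain ⟨y, hy, hnear⟩ := key
  obtain ⟨c, -, hc⟩ := Z.code he hs0 hs1 (pre_emb he hρ hy)
  obtain ⟨c', -, hc'⟩ := Z.code he hs0 hs1 (pre_emb he hρ' hy)
  have hcc : c ≠ c' := by
    rintro rfl
    exact hnear (hc.trans hc'.symm)
  refine ⟨s * y - algebraMap k M c', ?_, ?_, ?_⟩
  · have h1 : ρ (s * y - algebraMap k M c') = s0 * ρ y - algebraMap k Λ c' := by simp [hρ]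
    rw [h1]
    have h2 : Near Z.v (s0 * ρ y - algebraMap k Λ c') (algebraMap k Λ (c - c')) := by
      unfold Near at hc ⊢
      rw [map_sub (algebraMap k Λ)]
      have h3 : s0 * ρ y - algebraMap k Λ c' - (algebraMap k Λ c - algebraMap k Λ c') =
        s0 * ρ y - algebraMap k Λ c := by ring
      rw [h3]; exact hc
    exact h2.eq_one (Z.hk _ (sub_ne_zero.2 hcc))
  · have h1 : ρ' (s * y - algebraMap k M c') = s0 * ρ' y - algebraMap k Λ c' := by simp [hρ']
    rw [h1]; exact hc'
  · intro τ hτ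
    have h1 : τ (s * y - algebraMap k M c') = s0 * τ y - algebraMap k Λ c' := by simp [hτ]
    rw [h1]
    exact Valuation.map_sub_le Z.v (pre_le_one he hs0 hs1 (pre_emb he hτ hy)) (Z.alg_le _)

include hs0 hs1 he hd hQ hgen in
lemma exists_eps (J : Finset (M →ₐ[k] Λ)) (hJ : ∀ ρ ∈ J, ρ s = s0) :
    ∃ ε : (M →ₐ[k] Λ) → M, (∀ ρ ∈ J, Z.v (ρ (ε ρ)) = 1) ∧
      ∀ ρ ∈ J, ∀ ρ' ∈ J, ρ ≠ ρ' → Z.v (ρ (ε ρ')) < 1 := by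
  classical
  have h : ∀ ρ ρ' : M →ₐ[k] Λ, ∃ f : M, ρ s = s0 → ρ' s = s0 → ρ ≠ ρ' → Z.v (ρ f) = 1 ∧ Z.v (ρ' f) < 1 ∧
      ∀ τ : M →ₐ[k] Λ, τ s = s0 → Z.v (τ f) ≤ 1 := by
    intro ρ ρ'
    by_cases h1 : ρ s = s0 ∧ ρ' s = s0 ∧ ρ ≠ ρ'
    · obtain ⟨f, hf⟩ := sep Z hs0 hs1 he hd hQ hgen h1.1 h1.2.1 h1.2.2
      exact ⟨f, fun _ _ _ => hf⟩
    · exact ⟨0, fun a b c => absurd ⟨a, b, c⟩ h1⟩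
  choose f hf using h
  refine ⟨fun ρ => ∏ ρ' ∈ J.erase ρ, f ρ ρ', ?_, ?_⟩
  · intro ρ hρ
    rw [map_prod, map_prod]
    refine Finset.prod_eq_one fun ρ' hρ' => ?_
    rw [Finset.mem_erase] at hρ'
    exact (hf ρ ρ' (hJ _ hρ) (hJ _ hρ'.2) hρ'.1.symm).1
  · intro ρ hρ ρ' hρ' hne
    rw [map_prod, map_prod, ← Finset.mul_prod_erase _ _ (Finset.mem_erase.2 ⟨hne, hρ⟩)]
    refine mul_lt_one_of_nonneg_of_lt_one_left zero_le
      (hf ρ' ρ (hJ _ hρ') (hJ _ hρ) hne.symm).2.1 ?_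
    refine Finset.prod_le_one' fun τ hτ => ?_
    rw [Finset.mem_erase, Finset.mem_erase] at hτ
    exact (hf ρ' τ (hJ _ hρ') (hJ _ hτ.2.2) hτ.2.1.symm).2.2 ρ (hJ _ hρ)

include hs0 hs1 he hd hQ hgen in
lemma exists_psi {q : ℕ} (hq : q ≠ 0) (hqd : q ≡ 1 [MOD d]) (fr : Λ →+* Λ)
    (hfr : ∀ x, fr x = x ^ q) (φ : Λ →ₐ[k] Λ) (hφ : φ s0 = s0 ^ q)
    (hφv : ∀ y, Z.v y < 1 → Z.v (φ y) < 1) {ρ1 : M →ₐ[k] Λ} (hρ1 : ρ1 s = s0) :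
    ∃ ψ : M →ₐ[k] M, ψ s = s ^ q ∧ ∀ ρ : M →ₐ[k] Λ, ρ s = s0 → ∀ m, ρ (ψ m) = φ (ρ m) := by
  have hfrob : ∀ ρ : M →ₐ[k] Λ, ρ s = s0 → ∀ x ∈ Q, φ (ρ x) = ρ (x ^ q) := fun ρ hρ x hx => by
    rw [map_pow]
    exact Z.frob he hs0 hs1 hd hq hqd fr hfr φ hφ hφv (pre_emb he hρ (hQ x hx))
  have hr' : ∀ m, φ (ρ1 m) ∈ ρ1.fieldRange := by
    intro x
    have hx : x ∈ IntermediateField.adjoin k (insert s Q) := by rw [hgen]; trivial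
    induction hx using IntermediateField.adjoin_induction with
    | mem x hx =>
      rcases hx with rfl | hx
      · exact ⟨x ^ q, by simp [hρ1, hφ]⟩
      · exact ⟨x ^ q, (hfrob ρ1 hρ1 x hx).symm⟩
    | algebraMap c => exact ⟨algebraMap k M c, by simp⟩
    | add x y _ _ h1 h2 => rw [map_add, map_add]; exact add_mem h1 h2
    | inv x _ h1 => rw [map_inv₀, map_inv₀]; exact inv_mem h1
    | mul x y _ _ h1 h2 => rw [map_mul, map_mul]; exact mul_mem h1 h2
  have hr : ∀ m, φ (ρ1 m) ∈ ρ1.range := hr'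
  let eqv := AlgEquiv.ofInjectiveField ρ1
  let ψ : M →ₐ[k] M := (eqv.symm : ρ1.range →ₐ[k] M).comp
    ((φ.comp ρ1).codRestrict ρ1.range hr)
  have hψ : ∀ m, ρ1 (ψ m) = φ (ρ1 m) := by
    intro m
    have : eqv (ψ m) = ⟨φ (ρ1 m), hr m⟩ := eqv.apply_symm_apply _
    exact congrArg Subtype.val this
  have hψs : ψ s = s ^ q := ρ1.toRingHom.injective (by
    change ρ1 _ = ρ1 _
    rw [hψ, hρ1, hφ, map_pow, hρ1])
  refine ⟨ψ, hψs, ?_⟩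
  intro ρ hρ
  have : ρ.comp ψ = φ.comp ρ := by
    refine hom_ext_gen hgen ?_ ?_
    · simp [hψs, hρ, hφ]
    · intro x hx
      have h1 : ψ x = x ^ q := ρ1.toRingHom.injective (by
        change ρ1 _ = ρ1 _
        rw [hψ, hfrob ρ1 hρ1 x hx])
      simp only [AlgHom.comp_apply]
      rw [h1, hfrob ρ hρ x hx]
  exact fun m => DFunLike.congr_fun this m
end sepa

end part8

section part9
open Polynomial
open scoped NNReal IntermediateField

section bnd
variable {k M Λ : Type*} [Field k] [Field M] [Field Λ] [Algebra k M] [Algebra k Λ] (Z : Loc k Λ)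

lemma Loc.avoid [Infinite k] {ι : Type*} (J : Finset ι) (a : ι → Λ) :
    ∃ c : k, ∀ i ∈ J, 1 ≤ Z.v (a i - algebraMap k Λ c) := by
  have hfin : (⋃ i ∈ J, {c : k | Z.v (a i - algebraMap k Λ c) < 1}).Finite := by
    refine Set.Finite.biUnion J.finite_toSet fun i _ => ?_
    refine Set.Subsingleton.finite ?_
    intro c hc c' hc'
    exact Z.near_alg (Near.trans (Near.symm (v := Z.v) hc) hc')
  obtain ⟨c, hc⟩ := hfin.exists_notMem
  refine ⟨c, fun i hi => ?_⟩
  by_contra h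
  push Not at h
  exact hc (Set.mem_biUnion hi h)

lemma psi_ne (hM : FFld k M) {s : M} (hs : Transcendental k s) {q : ℕ} (hq : 2 ≤ q) (ψ : M →ₐ[k] M)
    (hψ : ψ s = s ^ q) {t : M} (ht : Transcendental k t) : ψ t ≠ t := by
  intro hfix
  have hfd := hM.2 t ht
  have hfix' : ∀ a ∈ k⟮t⟯, ψ a = a := by
    intro a ha
    induction ha using IntermediateField.adjoin_induction with
    | mem x hx => rw [Set.mem_singleton_iff] at hx; rw [hx]; exact hfix
    | algebraMap c => simp
    | add x y _ _ h1 h2 => simp [h1, h2]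
    | inv x _ h1 => simp [h1]
    | mul x y _ _ h1 h2 => simp [h1, h2]
  let g := minpoly k⟮t⟯ s
  let ψ' : M →ₐ[k⟮t⟯] M := { ψ with commutes' := fun r => hfix' r r.2 }
  have hroot : ∀ n : ℕ, aeval (s ^ (q ^ n)) g = 0 := by
    intro n
    induction n with
    | zero => simp [g]
    | succ n ih =>
      have h1 : s ^ q ^ (n + 1) = ψ' (s ^ q ^ n) := by
        rw [map_pow]
        change _ = (ψ s) ^ _
        rw [hψ, ← pow_mul, pow_succ, mul_comm]
      rw [h1, aeval_algHom_apply, ih, map_zero]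
  have hg : g ≠ 0 := minpoly.ne_zero (Algebra.IsIntegral.isIntegral s)
  have hfin : (g.rootSet M).Finite := rootSet_finite g M
  have hinj : Function.Injective fun n : ℕ => s ^ (q ^ n) := by
    have h1 : ∀ a b : ℕ, a < b → s ^ a ≠ s ^ b := by
      intro a b hab h
      apply hs
      refine ⟨X ^ b - X ^ a, ?_, by simp [h]⟩
      intro h0
      have := congrArg (fun P => coeff P b) h0
      simp [coeff_X_pow, hab.ne'] at this
    intro a b hab
    have h2 : q ^ a = q ^ b := by
      by_contra hne
      rcases Nat.lt_or_gt_of_ne hne with h | h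
      · exact h1 _ _ h hab
      · exact h1 _ _ h hab.symm
    exact Nat.pow_right_injective hq h2
  refine Set.infinite_range_of_injective hinj (hfin.subset ?_)
  rintro _ ⟨n, rfl⟩
  exact (mem_rootSet_of_ne hg).2 (hroot n)

theorem card_emb_le [IsAlgClosed k] (hM : FFld k M)
    {s0 : Λ} (hs0 : s0 ≠ 0) (hs1 : Z.v s0 < 1) {d e : ℕ} (he : e + 2 ≤ d) (hd : (d : k) ≠ 0)
    {s : M} (hs : Transcendental k s) {Q : Set M} (hQ : ∀ x ∈ Q, Pre d e (s ^ d)⁻¹ x)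
    (hgen : IntermediateField.adjoin k (insert s Q) = ⊤)
    {q : ℕ} (hq : 2 ≤ q) (hqd : q ≡ 1 [MOD d]) (fr : Λ →+* Λ)
    (hfr : ∀ x, fr x = x ^ q) (φ : Λ →ₐ[k] Λ) (hφ : φ s0 = s0 ^ q)
    (hφv : ∀ y, Z.v y < 1 → Z.v (φ y) < 1) {t : M} (ht : Transcendental k t)
    (J : Finset (M →ₐ[k] Λ)) (hJ : ∀ ρ ∈ J, ρ s = s0) : J.card ≤ (q + 1) * dg k t := by
  have hinf : Infinite k := IsAlgClosed.instInfinite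
  rcases J.eq_empty_or_nonempty with rfl | ⟨ρ1, hρ1⟩
  · simp
  obtain ⟨ψ, hψ, hψφ⟩ := exists_psi Z hs0 hs1 he hd hQ hgen (by omega) hqd fr hfr φ hφ hφv (hJ _ hρ1)
  -- normalise t
  obtain ⟨c, hc⟩ := Z.avoid J (fun ρ => ρ t)
  obtain ⟨c', hc'⟩ := Z.avoid J (fun ρ => ρ ((t - algebraMap k M c)⁻¹))
  set t' : M := (t - algebraMap k M c)⁻¹ - algebraMap k M c' with ht'
  have hdg : dg k t' = dg k t := by rw [ht', dg_sub_alg, dg_inv, dg_sub_alg]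
  have htt : Transcendental k t' := by
    intro h
    have h1 := dg_pos hM ht
    rw [← hdg, dg_algebraic hM h] at h1
    exact lt_irrefl _ h1
  have hv : ∀ ρ ∈ J, Z.v (ρ t') = 1 := by
    intro ρ hρ
    have h1 := hc ρ hρ
    have h2 := hc' ρ hρ
    have h3 : ρ t' = ρ ((t - algebraMap k M c)⁻¹) - algebraMap k Λ c' := by simp [ht']
    rw [h3]
    refine le_antisymm (Valuation.map_sub_le Z.v ?_ (Z.alg_le _)) h2
    rw [map_inv₀, map_inv₀, map_sub ρ, AlgHom.commutes]
    exact inv_le_one_of_one_le₀ h1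
  set u : M := ψ t' * t'⁻¹ - algebraMap k M 1 with hu
  have ht0 : t' ≠ 0 := by intro h; rw [h] at htt; exact htt isAlgebraic_zero
  have hvu : ∀ ρ ∈ J, Z.v (ρ u) < 1 := by
    intro ρ hρ
    have h1 := hv ρ hρ
    have h2 : u = (ψ t' - t') * t'⁻¹ := by
      rw [hu, map_one]; field_simp
    rw [h2, map_mul, map_mul, map_inv₀, map_inv₀, h1, inv_one, mul_one, map_sub ρ, hψφ ρ (hJ _ hρ)]
    obtain ⟨a, ha⟩ := Z.hres _ h1.le
    have h3 := hφv _ ha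
    rw [map_sub φ, AlgHom.commutes] at h3
    exact Near.trans (v := Z.v) h3 (Near.symm (v := Z.v) ha)
  have hut : Transcendental k u := by
    intro h
    obtain ⟨a, ha⟩ := alg_mem h
    have h1 := hvu ρ1 hρ1
    rw [← ha, AlgHom.commutes] at h1
    have ha0 : a = 0 := by
      by_contra h0
      rw [Z.hk _ h0] at h1
      exact lt_irrefl _ h1
    rw [ha0, map_zero, hu, map_one, eq_comm, sub_eq_zero, mul_inv_eq_one₀ ht0] at ha
    exact psi_ne hM hs hq ψ hψ htt ha
  obtain ⟨ε, hε1, hε2⟩ := exists_eps Z hs0 hs1 he hd hQ hgen J hJ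
  have h1 := card_le_dg Z J u hut (hM.2 u hut) hvu ε hε1 hε2
  have h2 : dg k u ≤ dg k (ψ t') + dg k t' := by
    rw [hu, dg_sub_alg]
    refine (dg_mul_le hM _ _).trans ?_
    rw [dg_inv]
  have h3 : dg k (s ^ q) ≤ q * dg k s := by
    have := dg_prod_le hM (Multiset.replicate q s) (dg k s) (by
      intro a ha; rw [Multiset.eq_of_mem_replicate ha])
    simpa using this
  rw [← hψ, dg_map, mul_comm] at h3
  have h4 : Module.finrank ψ.fieldRange M ≤ q := Nat.le_of_mul_le_mul_right h3 (dg_pos hM hs)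
  rw [dg_map, hdg] at h2
  refine h1.trans (h2.trans ?_)
  nlinarith
end bnd

end part9

section part10
open Polynomial
open scoped NNReal IntermediateField

lemma val_multiset_prod_lt {Λ : Type*} [Field Λ] (v : Valuation Λ ℝ≥0) (m : Multiset Λ) (h0 : m ≠ 0)
    (h : ∀ a ∈ m, v a < 1) : v m.prod < 1 := by
  induction m using Multiset.induction_on with
  | empty => exact absurd rfl h0
  | cons a m ih =>
    rw [Multiset.prod_cons, map_mul]
    have h1 := h a (by simp)
    by_cases hm : m = 0
    · simp [hm, h1]
    · exact mul_lt_one_of_nonneg_of_lt_one_left zero_le h1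
        (ih hm fun b hb => h b (by simp [hb])).le

section zer
variable {k M Λ : Type*} [Field k] [Field M] [Field Λ] [Algebra k M] [Algebra k Λ] (Z : Loc k Λ)

lemma Loc.aeval_big {w0 : Λ} (h0 : w0 ≠ 0) (hw : Z.v w0⁻¹ < 1) (P : k[X]) (h : Z.v (aeval w0 P) < 1) : P = 0 := by
  by_contra hP
  let := invertibleOfNonzero h0
  have h1 := eval₂_reverse_mul_pow (algebraMap k Λ) w0 P
  rw [invOf_eq_inv] at h1
  have h2 := Z.near_aeval P.reverse hw
  rw [coeff_zero_reverse] at h2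
  have h3 := h2.eq_one (Z.hk _ (leadingCoeff_ne_zero.2 hP))
  rw [aeval_def] at h3 h
  rw [← h1, map_mul, h3, one_mul, map_pow] at h
  rw [map_inv₀] at hw
  have h4 : 1 < Z.v w0 := by
    have := (Valuation.pos_iff Z.v).2 h0
    exact (inv_lt_one₀ this).1 hw
  exact absurd h (not_lt.2 (one_le_pow₀ h4.le))

lemma Loc.transc [IsAlgClosed k] {s0 : Λ} (h0 : s0 ≠ 0) (h1 : Z.v s0 < 1) : Transcendental k s0 := by
  intro h
  obtain ⟨c, rfl⟩ := alg_mem h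
  rw [Z.hk c (by rintro rfl; simp at h0)] at h1
  exact lt_irrefl _ h1

lemma exists_j {w : M} {w0 : Λ} (hw : Transcendental k w) (hw0 : Transcendental k w0) :
    ∃ j : k⟮w⟯ →ₐ[k] Λ, j (IntermediateField.AdjoinSimple.gen k w) = w0 := by
  refine ⟨(k⟮w0⟯.val).comp (((RatFunc.algEquivOfTranscendental w0 hw0) : RatFunc k →ₐ[k] k⟮w0⟯).comp
    ((RatFunc.algEquivOfTranscendental w hw).symm : k⟮w⟯ →ₐ[k] RatFunc k)), ?_⟩
  change k⟮w0⟯.val (RatFunc.algEquivOfTranscendental w0 hw0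
    ((RatFunc.algEquivOfTranscendental w hw).symm (IntermediateField.AdjoinSimple.gen k w))) = w0
  rw [RatFunc.algEquivOfTranscendental_symm_gen]
  simp [RatFunc.algEquivOfTranscendental_X]

lemma exists_emb [IsAlgClosed Λ] {w : M} {w0 : Λ} (hw : Transcendental k w)
    (hw0 : Transcendental k w0) (hM : FFld k M) : ∃ ρ : M →ₐ[k] Λ, ρ w = w0 := by
  obtain ⟨j, hj⟩ := exists_j hw hw0
  have := hM.2 w hw
  obtain ⟨ρ, hρ⟩ := exists_extend (A := M) (j : k⟮w⟯ →+* Λ)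
  refine ⟨{ ρ with commutes' := fun c => ?_ }, ?_⟩
  · have := hρ (algebraMap k k⟮w⟯ c)
    rw [← IsScalarTower.algebraMap_apply] at this
    exact this.trans (j.commutes c)
  · exact (hρ (IntermediateField.AdjoinSimple.gen k w)).trans hj

open scoped IntermediateField.algebraAdjoinAdjoin in
lemma zero_of_small [IsAlgClosed Λ] {w : M} {w0 : Λ} (hw : Transcendental k w)
    (hw0 : Transcendental k w0) (h1 : Z.v w0⁻¹ < 1) (hM : FFld k M) {z : M}
    (hz : IsIntegral (Algebra.adjoin k {w}) z) (h : ∀ ρ : M →ₐ[k] Λ, ρ w = w0 → Z.v (ρ z) < 1) :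
    z = 0 := by
  have hfd := hM.2 w hw
  obtain ⟨j, hj⟩ := exists_j hw hw0
  have hic : IsIntegrallyClosed (Algebra.adjoin k {w}) :=
    IsIntegrallyClosed.of_equiv (Polynomial.algEquivOfTranscendental k w hw).toRingEquiv
  have hf : minpoly k⟮w⟯ z = (minpoly (Algebra.adjoin k {w}) z).map
      (algebraMap (Algebra.adjoin k {w}) k⟮w⟯) := minpoly.isIntegrallyClosed_eq_field_fractions' _ hz
  have hz' : IsIntegral k⟮w⟯ z := Algebra.IsIntegral.isIntegral z
  let alg : Algebra k⟮w⟯ Λ := j.toRingHom.toAlgebra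
  have htow : IsScalarTower k k⟮w⟯ Λ := IsScalarTower.of_algebraMap_eq fun c => (j.commutes c).symm
  have hroots : ∀ r ∈ ((minpoly k⟮w⟯ z).map (algebraMap k⟮w⟯ Λ)).roots, Z.v r < 1 := by
    intro r hr
    have hr' : r ∈ (minpoly k⟮w⟯ z).rootSet Λ := by
      classical
      rw [rootSet_def]; simpa [aroots] using hr
    rw [← Algebra.IsAlgebraic.range_eval_eq_rootSet_minpoly Λ z] at hr'
    obtain ⟨ρ, rfl⟩ := hr'
    refine h (ρ.restrictScalars k) ?_
    exact (ρ.commutes (IntermediateField.AdjoinSimple.gen k w)).trans hj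
  have hmon := (minpoly.monic hz').map (algebraMap k⟮w⟯ Λ)
  have hprod := (IsAlgClosed.splits ((minpoly k⟮w⟯ z).map (algebraMap k⟮w⟯ Λ))).eval_eq_prod_roots_of_monic
    hmon 0
  have hlt : Z.v (eval 0 ((minpoly k⟮w⟯ z).map (algebraMap k⟮w⟯ Λ))) < 1 := by
    rw [hprod]
    refine val_multiset_prod_lt _ _ ?_ ?_
    · intro h0
      rw [Multiset.map_eq_zero] at h0
      have h2 := (IsAlgClosed.splits ((minpoly k⟮w⟯ z).map (algebraMap k⟮w⟯ Λ))).natDegree_eq_card_roots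
      rw [h0, natDegree_map, Multiset.card_zero] at h2
      exact (minpoly.natDegree_pos hz').ne' h2
    · intro a ha
      rw [Multiset.mem_map] at ha
      obtain ⟨r, hr, rfl⟩ := ha
      rw [zero_sub, Valuation.map_neg]
      exact hroots r hr
  rw [← coeff_zero_eq_eval_zero, coeff_map, hf, coeff_map] at hlt
  obtain ⟨P, hP⟩ : ∃ P : k[X], aeval w P = ((minpoly (Algebra.adjoin k {w}) z).coeff 0 : M) :=
    (le_of_eq (Algebra.adjoin_singleton_eq_range_aeval k w))
      ((minpoly (Algebra.adjoin k {w}) z).coeff 0).2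
  have hP' : algebraMap (Algebra.adjoin k {w}) k⟮w⟯ ((minpoly (Algebra.adjoin k {w}) z).coeff 0) =
      aeval (IntermediateField.AdjoinSimple.gen k w) P := by
    apply Subtype.ext
    have h3 := aeval_algHom_apply (k⟮w⟯.val) (IntermediateField.AdjoinSimple.gen k w) P
    exact hP.symm.trans h3
  have h4 : algebraMap k⟮w⟯ Λ (aeval (IntermediateField.AdjoinSimple.gen k w) P) = aeval w0 P := by
    rw [← hj]; exact (aeval_algHom_apply j _ P).symm
  rw [hP', h4] at hlt
  have hP0 := Z.aeval_big (by rintro rfl; exact hw0 isAlgebraic_zero) h1 P hlt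
  rw [← minpoly.coeff_zero_eq_zero hz', hf, coeff_map, hP', hP0, map_zero]

lemma integral_of_pre {s : M} {d e : ℕ} (he : e + 2 ≤ d) {x : M} (h : Pre d e (s ^ d)⁻¹ x) :
    IsIntegral (Algebra.adjoin k {s⁻¹}) x := by
  have h1 : x ∈ (⨅ V : {V : ValuationSubring M // (Algebra.adjoin k {s⁻¹} : Set M) ⊆ V.toSubring},
      V.1.toSubring) := by
    rw [Subring.mem_iInf]
    rintro ⟨V, hV⟩
    by_contra hx
    have hx' : 1 < V.valuation x := by
      rw [← not_le, V.valuation_le_one_iff]; exact hx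
    refine not_pre_of_big he V.valuation hx' ?_ h
    have h2 : V.valuation s⁻¹ ≤ 1 := by
      rw [V.valuation_le_one_iff]; exact hV (Algebra.self_mem_adjoin_singleton k s⁻¹)
    refine lt_of_le_of_lt (b := 1) ?_ (one_lt_pow₀ hx' (by omega))
    rw [← inv_pow, map_pow]
    exact pow_le_one₀ zero_le h2
  rw [iInf_valuationSubring_superset] at h1
  obtain ⟨p, hp, hp0⟩ := h1
  have hle : Subring.closure (Algebra.adjoin k {s⁻¹} : Set M) ≤ (Algebra.adjoin k {s⁻¹}).toSubring :=
    Subring.closure_le.2 (fun _ h => h)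
  refine ⟨p.map (Subring.inclusion hle), hp.map _, ?_⟩
  rw [eval₂_map]
  exact hp0
end zer

end part10

section part11
open Polynomial
open scoped NNReal IntermediateField

lemma transc_inv {k F : Type*} [Field k] [Field F] [Algebra k F] {a : F} (h : Transcendental k a) :
    Transcendental k a⁻¹ := by
  intro h'
  have := h'.inv
  rw [inv_inv] at this
  exact h this

theorem count_M {k M Λ : Type*} [Field k] [Field M] [Field Λ] [Algebra k M] [Algebra k Λ]
    (Z : Loc k Λ) [IsAlgClosed k] [IsAlgClosed Λ] (hM : FFld k M)
    {s0 : Λ} (hs0 : s0 ≠ 0) (hs1 : Z.v s0 < 1) {d e : ℕ} (he : e + 2 ≤ d) (hd : (d : k) ≠ 0)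
    {s : M} (hs : Transcendental k s) {Q : Finset M} (hQ : ∀ x ∈ Q, Pre d e (s ^ d)⁻¹ x)
    (hgen : IntermediateField.adjoin k (insert s (Q : Set M)) = ⊤)
    {q : ℕ} (hq : 2 ≤ q) (hqd : q ≡ 1 [MOD d]) (fr : Λ →+* Λ)
    (hfr : ∀ x, fr x = x ^ q) (φ : Λ →ₐ[k] Λ) (hφ : φ s0 = s0 ^ q)
    (hφv : ∀ y, Z.v y < 1 → Z.v (φ y) < 1) {t : M} (ht : Transcendental k t) :
    Q.card ≤ ((d + 1) ^ 2) ^ ((q + 1) * dg k t) := by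
  classical
  have hbound : ∀ J : Finset (M →ₐ[k] Λ), (∀ ρ ∈ J, ρ s = s0) → J.card ≤ (q + 1) * dg k t :=
    fun J hJ => card_emb_le Z hM hs0 hs1 he hd hs (Q := (Q : Set M)) hQ hgen hq hqd fr hfr φ hφ hφv ht J hJ
  have hfin : {ρ : M →ₐ[k] Λ | ρ s = s0}.Finite := by
    by_contra hinf
    obtain ⟨J, hJ, hc⟩ := Set.Infinite.exists_subset_card_eq hinf ((q + 1) * dg k t + 1)
    have := hbound J fun ρ hρ => hJ hρ
    omega
  obtain ⟨J, hJ⟩ : ∃ J : Finset (M →ₐ[k] Λ), ∀ ρ, ρ ∈ J ↔ ρ s = s0 :=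
    ⟨hfin.toFinset, fun ρ => by simp⟩
  obtain ⟨ρ1, hρ1⟩ := exists_emb hs (Z.transc hs0 hs1) hM
  let R : Finset k := insert 0 (nthRootsFinset d (1 : k))
  have hRcard : R.card ≤ d + 1 := by
    refine (Finset.card_insert_le _ _).trans ?_
    have h1 : (nthRootsFinset d (1 : k)).card ≤ d := by
      rw [nthRootsFinset_def]
      exact (Multiset.toFinset_card_le _).trans (card_nthRoots d 1)
    omega
  have hcode : ∀ (ρ : J) (y : M), ∃ c : R, Pre d e (s ^ d)⁻¹ y →
      Near Z.v (s0 * (ρ : M →ₐ[k] Λ) y) (algebraMap k Λ c) := by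
    intro ρ y
    by_cases hy : Pre d e (s ^ d)⁻¹ y
    · obtain ⟨c, hc, hn⟩ := Z.code he hs0 hs1 (pre_emb he ((hJ _).1 ρ.2) hy)
      refine ⟨⟨c, ?_⟩, fun _ => hn⟩
      rcases hc with rfl | hc
      · exact Finset.mem_insert_self _ _
      · exact Finset.mem_insert_of_mem ((mem_nthRootsFinset (by omega) 1).2 hc)
    · exact ⟨⟨0, Finset.mem_insert_self _ _⟩, fun h => absurd h hy⟩
  choose c hc using hcode
  let G : Q → (J → R × R) := fun x ρ => (c ρ x, c ρ (fa d e (s ^ d)⁻¹ x))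
  have hzero : ∀ x y : M, Pre d e (s ^ d)⁻¹ x → Pre d e (s ^ d)⁻¹ y → (∀ ρ, c ρ x = c ρ y) →
      x = 0 → y = 0 := by
    rintro x y hx hy h rfl
    by_contra hy0
    have h1 := hc ⟨ρ1, (hJ _).2 hρ1⟩ 0 hx
    have h2 := hc ⟨ρ1, (hJ _).2 hρ1⟩ y hy
    rw [h] at h1
    have h3 := h2.trans h1.symm
    simp only [map_zero, mul_zero, Near, sub_zero] at h3
    rw [pre_eq_one he hs0 hs1 (pre_emb he hρ1 hy) (by simpa using hy0)] at h3
    exact lt_irrefl _ h3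
  have hGinj : Function.Injective G := by
    rintro ⟨x, hxQ⟩ ⟨y, hyQ⟩ hxy
    apply Subtype.ext
    have hx := hQ x hxQ
    have hy := hQ y hyQ
    have h1 : ∀ ρ, c ρ x = c ρ y := fun ρ => congrArg Prod.fst (congrFun hxy ρ)
    have h2 : ∀ ρ, c ρ (fa d e (s ^ d)⁻¹ x) = c ρ (fa d e (s ^ d)⁻¹ y) :=
      fun ρ => congrArg Prod.snd (congrFun hxy ρ)
    change x = y
    by_cases hx0 : x = 0
    · rw [hzero x y hx hy h1 hx0, hx0]
    by_cases hy0 : y = 0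
    · exact absurd (hzero y x hy hx (fun ρ => (h1 ρ).symm) hy0) hx0
    rw [← sub_eq_zero]
    have hs00 := Z.transc hs0 hs1
    refine zero_of_small Z (w := s⁻¹) (w0 := s0⁻¹) (transc_inv hs) (transc_inv hs00) (by rwa [inv_inv])
      hM ((integral_of_pre he hx).sub (integral_of_pre he hy)) ?_
    intro ρ hρ
    have hρs : ρ s = s0 := by
      rw [map_inv₀] at hρ; exact inv_injective hρ
    have hxp := pre_emb he hρs hx
    have hyp := pre_emb he hρs hy
    have hm := (hJ _).2 hρs
    have n1 := (hc ⟨ρ, hm⟩ x hx).trans ((h1 ⟨ρ, hm⟩) ▸ (hc ⟨ρ, hm⟩ y hy).symm)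
    have n2 := (hc ⟨ρ, hm⟩ _ (hx.step hx0)).trans ((h2 ⟨ρ, hm⟩) ▸ (hc ⟨ρ, hm⟩ _ (hy.step hy0)).symm)
    have key := pre_diff he hs0 hs1 (Z.natCast hd) hxp hyp (by simpa using hx0) (by simpa using hy0) n1
    have f1 : fa d e (s0 ^ d)⁻¹ (ρ x) = ρ (fa d e (s ^ d)⁻¹ x) := by simp [fa, hρs]
    have f2 : fa d e (s0 ^ d)⁻¹ (ρ y) = ρ (fa d e (s ^ d)⁻¹ y) := by simp [fa, hρs]
    rw [f1, f2, ← mul_sub, map_mul, ← map_sub ρ] at key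
    have hvs : 0 < Z.v s0 := (Valuation.pos_iff Z.v).2 hs0
    have hlt : Z.v s0 * Z.v (ρ (x - y)) < Z.v s0 * 1 := by
      rw [key, mul_one]
      have h3 : Z.v s0 ^ (d - e - 1) ≤ Z.v s0 := by
        obtain ⟨m, hm⟩ : ∃ m, d - e - 1 = m + 1 := ⟨d - e - 2, by omega⟩
        rw [hm, pow_succ]
        exact mul_le_of_le_one_left zero_le (pow_le_one₀ zero_le hs1.le)
      calc _ < Z.v s0 ^ (d - e - 1) * 1 := mul_lt_mul_of_pos_left n2 (pow_pos hvs _)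
        _ ≤ _ := by rwa [mul_one]
    exact lt_of_mul_lt_mul_left hlt zero_le
  have hcard := Fintype.card_le_of_injective G hGinj
  rw [Fintype.card_fun, Fintype.card_prod, Fintype.card_coe, Fintype.card_coe, Fintype.card_coe] at hcard
  refine hcard.trans ?_
  calc (R.card * R.card) ^ J.card ≤ ((d + 1) ^ 2) ^ J.card := by
        apply Nat.pow_le_pow_left; rw [sq]; exact Nat.mul_le_mul hRcard hRcard
    _ ≤ _ := Nat.pow_le_pow_right (by positivity) (hbound J fun ρ hρ => (hJ ρ).1 hρ)

/-- main counting theorem over an algebraically closed constant field -/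
theorem count_L {k : Type} [Field k] [IsAlgClosed k] {F : Type*} [Field F] [Algebra k F]
    (hF : FFld k F) {p : ℕ} [Fact p.Prime] [CharP k p] {d e : ℕ} (he : e + 2 ≤ d) (hpd : ¬ p ∣ d)
    {s T : F} (hs : Transcendental k s) (hT : Transcendental k T)
    (Q : Finset F) (hQ : ∀ x ∈ Q, Pre d e (s ^ d)⁻¹ x) :
    Q.card ≤ ((d + 1) ^ 2) ^ ((p ^ d.totient + 1) * dg k T) := by
  classical
  obtain ⟨Λ, _, _, _, Z, s0, hs0, hs1, hφ⟩ := exists_loc k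
  have hp : p.Prime := Fact.out
  have htot : 0 < d.totient := Nat.totient_pos.2 (by omega)
  set q := p ^ d.totient with hq
  have hq2 : 2 ≤ q := hp.two_le.trans (Nat.le_self_pow htot.ne' p)
  have hqd : q ≡ 1 [MOD d] := Nat.ModEq.pow_totient ((Nat.Prime.coprime_iff_not_dvd hp).2 hpd)
  obtain ⟨φ, hφ1, hφ2⟩ := hφ q (by omega)
  have hchar : CharP Λ p := charP_of_injective_algebraMap (algebraMap k Λ).injective p
  have hd : (d : k) ≠ 0 := by rwa [Ne, CharP.cast_eq_zero_iff k p]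
  let M := IntermediateField.adjoin k (insert s (Q : Set F))
  have hsM : s ∈ M := IntermediateField.subset_adjoin _ _ (by simp)
  have hQM : ∀ x ∈ Q, x ∈ M := fun x hx => IntermediateField.subset_adjoin _ _ (by simp [hx])
  let sM : M := ⟨s, hsM⟩
  have hsMt : Transcendental k sM := fun h => hs (h.algebraMap (A := F))
  let QM : Finset M := Q.attach.image fun x : {x // x ∈ Q} => (⟨x.1, hQM x.1 x.2⟩ : M)
  have hfdM : FiniteDimensional M F := by
    have h1 := hF.2 s hs
    have hle : k⟮s⟯ ≤ M := by rw [IntermediateField.adjoin_simple_le_iff]; exact hsM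
    let := (IntermediateField.inclusion hle).toRingHom.toAlgebra
    have : IsScalarTower k⟮s⟯ M F := IsScalarTower.of_algebraMap_eq fun x => rfl
    exact FiniteDimensional.right k⟮s⟯ M F
  have hM : FFld k M := hF.down hsMt
  obtain ⟨t, ht, htT⟩ := lemG (M := M) hF hT
  have hgen : IntermediateField.adjoin k (insert sM (QM : Set M)) = ⊤ := by
    apply IntermediateField.map_injective M.val
    rw [IntermediateField.adjoin_map, ← AlgHom.fieldRange_eq_map, IntermediateField.fieldRange_val]
    change _ = IntermediateField.adjoin k (insert s (Q : Set F))
    congr 1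
    ext x
    simp [QM, sM, Set.image_insert_eq]
    exact or_congr Iff.rfl ⟨fun ⟨h, _⟩ => h, fun h => ⟨h, hQM x h⟩⟩
  have hinj : Function.Injective (fun x : {x // x ∈ Q} => (⟨x.1, hQM x.1 x.2⟩ : M)) := by
    intro a b h
    have h2 : a.1 = b.1 := congrArg (fun y : M => (y : F)) h
    exact Subtype.ext h2
  have hcard : QM.card = Q.card :=
    (Finset.card_image_of_injective Q.attach hinj).trans Finset.card_attach
  have hfr : ∀ x : Λ, iterateFrobenius Λ p d.totient x = x ^ q :=
    fun x => iterateFrobenius_def p d.totient x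
  have hQ' : ∀ x ∈ QM, Pre d e (sM ^ d)⁻¹ x := by
    intro x hx
    simp only [QM, Finset.mem_image, Finset.mem_attach, true_and] at hx
    obtain ⟨y, rfl⟩ := hx
    refine Pre.of_map (algebraMap M F) he ?_
    have := hQ y.1 y.2
    simpa [sM] using this
  have hres := count_M Z hM hs0 hs1 he hd hsMt hQ' hgen hq2 hqd _ hfr φ hφ1 hφ2 ht
  rw [hcard] at hres
  exact hres.trans (Nat.pow_le_pow_right (by positivity) (Nat.mul_le_mul_left _ htT))

end part11

section part12
open Polynomial
open scoped NNReal IntermediateField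

lemma exists_F_aux {kb Ω R L : Type*} [Field kb] [Field Ω] [Field R] [Field L] [Algebra kb Ω]
    [Algebra R L] [FiniteDimensional R L] [Algebra L Ω] [Algebra R Ω] [IsScalarTower R L Ω]
    {T : Ω} (hR : ∀ r : R, algebraMap R Ω r ∈ kb⟮T⟯) :
    ∃ G : IntermediateField kb⟮T⟯ Ω, (∀ x : L, algebraMap L Ω x ∈ G) ∧
      FiniteDimensional kb⟮T⟯ G ∧ Module.finrank kb⟮T⟯ G ≤ Module.finrank R L := by
  let j : R →+* kb⟮T⟯ := (algebraMap R Ω).codRestrict kb⟮T⟯.toSubring hR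
  let := j.toAlgebra
  have h1 : IsScalarTower R kb⟮T⟯ Ω := IsScalarTower.of_algebraMap_eq fun x => rfl
  let Φ : TensorProduct R kb⟮T⟯ L →ₐ[kb⟮T⟯] Ω :=
    Algebra.TensorProduct.lift (Algebra.ofId kb⟮T⟯ Ω) (IsScalarTower.toAlgHom R L Ω)
      (fun _ _ => Commute.all _ _)
  have hfd : FiniteDimensional kb⟮T⟯ Φ.range := inferInstanceAs (FiniteDimensional kb⟮T⟯ (LinearMap.range Φ.toLinearMap))
  have hfr : Module.finrank kb⟮T⟯ Φ.range ≤ Module.finrank R L := by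
    rw [← Module.finrank_baseChange (R := kb⟮T⟯) (S := R) (M' := L)]
    exact LinearMap.finrank_range_le Φ.toLinearMap
  have hf : IsField Φ.range := isField_of_isIntegral_of_isField' (Field.toIsField kb⟮T⟯)
  refine ⟨Φ.range.toIntermediateField' hf, fun x => ?_, hfd, hfr⟩
  exact ⟨1 ⊗ₜ x, by simp [Φ]⟩

lemma exists_F {kb Ω R L : Type*} [Field kb] [Field Ω] [Field R] [Field L] [Algebra kb Ω]
    [Algebra R L] [FiniteDimensional R L] [Algebra L Ω] [Algebra R Ω] [IsScalarTower R L Ω]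
    {T : Ω} (hT : Transcendental kb T) (hR : ∀ r : R, algebraMap R Ω r ∈ kb⟮T⟯) :
    ∃ F : IntermediateField kb Ω, (∀ x : L, algebraMap L Ω x ∈ F) ∧ FFld kb F ∧
      ∃ t : F, Transcendental kb t ∧ dg kb t ≤ Module.finrank R L := by
  obtain ⟨G, hG, hfd, hfr⟩ := exists_F_aux (L := L) hR
  let F := G.restrictScalars kb
  have hle : kb⟮T⟯ ≤ F := fun x hx => G.algebraMap_mem ⟨x, hx⟩
  let t : F := ⟨T, hle (IntermediateField.mem_adjoin_simple_self kb T)⟩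
  have ht : Transcendental kb t := fun h => hT (h.algebraMap (A := Ω))
  have hdg : dg kb t = Module.finrank kb⟮T⟯ G := by
    have h : kb⟮T⟯ = (kb⟮t⟯).map F.val := by
      rw [IntermediateField.adjoin_map]; simp [t]
    have h2 : (⊤ : IntermediateField kb F).map F.val = F := by
      rw [← AlgHom.fieldRange_eq_map, IntermediateField.fieldRange_val]
    have h3 : dg kb t = (kb⟮T⟯).relfinrank F := by
      unfold dg
      rw [← IntermediateField.relfinrank_map_map _ _ F.val, h2, ← h]
    rw [h3, IntermediateField.relfinrank_eq_finrank_of_le hle]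
    rfl
  have hpos : 0 < dg kb t := by rw [hdg]; exact Module.finrank_pos
  refine ⟨F, hG, FFld.of ht ?_, t, ht, hdg.le.trans hfr⟩
  rw [dg_eq] at hpos
  exact Module.finite_of_finrank_pos hpos

lemma core {k L Ω : Type} [Field k] [Field L] [Field Ω] [Algebra (RatFunc k) L]
    [FiniteDimensional (RatFunc k) L] [Algebra L Ω] [IsAlgClosed Ω] {p : ℕ} [Fact p.Prime] [CharP k p]
    {d e : ℕ} (he : e + 2 ≤ d) (hpd : ¬ p ∣ d) {s : L}
    (hs : ¬ AlgebraicOver ((algebraMap L Ω).comp ((algebraMap (RatFunc k) L).comp RatFunc.C))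
      (algebraMap L Ω s)) (Q : Finset L) (hQ : ∀ x ∈ Q, Pre d e (s ^ d)⁻¹ x) :
    Q.card ≤ ((d + 1) ^ 2) ^ ((p ^ d.totient + 1) * Module.finrank (RatFunc k) L) := by
  classical
  let ι := (algebraMap L Ω).comp ((algebraMap (RatFunc k) L).comp RatFunc.C)
  let : Algebra k Ω := ι.toAlgebra
  let : Algebra (RatFunc k) Ω := ((algebraMap L Ω).comp (algebraMap (RatFunc k) L)).toAlgebra
  have : IsScalarTower (RatFunc k) L Ω := IsScalarTower.of_algebraMap_eq fun x => rfl
  have hkΩ : ∀ x : k, algebraMap k Ω x = algebraMap (RatFunc k) Ω (RatFunc.C x) := fun x => rfl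
  have : IsScalarTower k (RatFunc k) Ω := IsScalarTower.of_algebraMap_eq fun x => by
    rw [hkΩ, RatFunc.algebraMap_eq_C]
  let kb := algebraicClosure k Ω
  have hcl : IsAlgClosed kb := (inferInstance : IsAlgClosure k kb).isAlgClosed
  have hchar : CharP kb p := charP_of_injective_algebraMap (algebraMap k kb).injective p
  have hsk : Transcendental k (algebraMap L Ω s) := by
    rintro ⟨P, hP, hP0⟩
    exact hs ⟨P, hP, by rwa [IsRoot, eval_map]⟩
  have hskb : Transcendental kb (algebraMap L Ω s) := hsk.algebraicClosure
  have hXk : Transcendental k (RatFunc.X : RatFunc k) := RatFunc.transcendental_X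
  have hTk : Transcendental k (algebraMap (RatFunc k) Ω RatFunc.X) := fun h =>
    hXk ((isAlgebraic_algebraMap_iff (algebraMap (RatFunc k) Ω).injective).1 h)
  have hTkb : Transcendental kb (algebraMap (RatFunc k) Ω RatFunc.X) := hTk.algebraicClosure
  have hR : ∀ r : RatFunc k, algebraMap (RatFunc k) Ω r ∈ kb⟮algebraMap (RatFunc k) Ω RatFunc.X⟯ := by
    intro r
    have hpoly : ∀ P : k[X], algebraMap (RatFunc k) Ω (algebraMap k[X] (RatFunc k) P) ∈
        kb⟮algebraMap (RatFunc k) Ω RatFunc.X⟯ := by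
      intro P
      induction P using Polynomial.induction_on' with
      | add P Q h1 h2 => rw [map_add, map_add]; exact add_mem h1 h2
      | monomial n a =>
        rw [← C_mul_X_pow_eq_monomial, map_mul, map_mul, map_pow, map_pow, RatFunc.algebraMap_X,
          RatFunc.algebraMap_C, ← hkΩ]
        refine mul_mem ?_ (pow_mem (IntermediateField.mem_adjoin_simple_self _ _) _)
        exact IntermediateField.algebraMap_mem _ (algebraMap k kb a)
    rw [← RatFunc.num_div_denom r, map_div₀]
    exact div_mem (hpoly _) (hpoly _)
  obtain ⟨F, hF, hFF, t, ht, hdg⟩ := exists_F (L := L) hTkb hR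
  let ρ : L →+* F := (algebraMap L Ω).codRestrict F.toSubring hF
  have hρs : Transcendental kb (ρ s) := fun h => hskb (h.algebraMap (A := Ω))
  have := count_L hFF he hpd hρs ht (Q.image ρ) (by
    intro x hx
    obtain ⟨y, hy, rfl⟩ := Finset.mem_image.1 hx
    have := (hQ y hy).map ρ he
    rwa [map_inv₀, map_pow] at this)
  rw [Finset.card_image_of_injective _ ρ.injective] at this
  exact this.trans (Nat.pow_le_pow_right (by positivity) (Nat.mul_le_mul_left _ hdg))

lemma core2 {k L Ω : Type} [Field k] [Field L] [Field Ω] [Algebra (RatFunc k) L]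
    [FiniteDimensional (RatFunc k) L] [Algebra L Ω] [IsAlgClosed Ω] {p : ℕ} [Fact p.Prime] [CharP k p]
    {d e : ℕ} (he : e + 2 ≤ d) (hpd : ¬ p ∣ d) {σ : L}
    (hs : ¬ AlgebraicOver ((algebraMap L Ω).comp ((algebraMap (RatFunc k) L).comp RatFunc.C))
      (algebraMap L Ω σ)) (Q : Finset L) (hQ : ∀ x ∈ Q, Pre d e σ x) :
    Q.card ≤ ((d + 1) ^ 2) ^ ((p ^ d.totient + 1) * (Module.finrank (RatFunc k) L * d)) := by
  classical
  obtain ⟨s, hsd⟩ := IsAlgClosed.exists_pow_nat_eq (algebraMap L Ω σ)⁻¹ (n := d) (by omega)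
  have hroot : aeval s (X ^ d - C σ⁻¹ : L[X]) = 0 := by simp [hsd]
  have hmon : (X ^ d - C σ⁻¹ : L[X]).Monic := monic_X_pow_sub_C _ (by omega)
  have hint : IsIntegral L s := ⟨_, hmon, hroot⟩
  have hfd : FiniteDimensional L L⟮s⟯ := IntermediateField.adjoin.finiteDimensional hint
  have hfr : Module.finrank L L⟮s⟯ ≤ d := by
    rw [IntermediateField.adjoin.finrank hint]
    have := natDegree_le_of_dvd (minpoly.dvd L s hroot) hmon.ne_zero
    rwa [natDegree_X_pow_sub_C] at this
  let : Algebra (RatFunc k) L⟮s⟯ := ((algebraMap L L⟮s⟯).comp (algebraMap (RatFunc k) L)).toAlgebra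
  have : IsScalarTower (RatFunc k) L L⟮s⟯ := IsScalarTower.of_algebraMap_eq fun x => rfl
  have hfd2 : FiniteDimensional (RatFunc k) L⟮s⟯ := FiniteDimensional.trans (RatFunc k) L L⟮s⟯
  let s' : L⟮s⟯ := IntermediateField.AdjoinSimple.gen L s
  have hs' : algebraMap L L⟮s⟯ σ = (s' ^ d)⁻¹ := by
    apply (algebraMap L⟮s⟯ Ω).injective
    rw [map_inv₀, map_pow, IntermediateField.AdjoinSimple.algebraMap_gen, hsd, inv_inv]
    rfl
  have h1 : ¬ AlgebraicOver ((algebraMap L⟮s⟯ Ω).comp ((algebraMap (RatFunc k) L⟮s⟯).comp RatFunc.C))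
      (algebraMap L⟮s⟯ Ω s') := by
    intro h
    apply hs
    let ι := (algebraMap L Ω).comp ((algebraMap (RatFunc k) L).comp RatFunc.C)
    change AlgebraicOver ι s at h
    let : Algebra k Ω := ι.toAlgebra
    obtain ⟨P, hP, hP0⟩ := h
    have hal : IsAlgebraic k s := ⟨P, hP, by rwa [IsRoot, eval_map] at hP0⟩
    have h2 := (hal.pow d).inv
    rw [hsd, inv_inv] at h2
    obtain ⟨P, hP, hP0⟩ := h2
    exact ⟨P, hP, by rwa [IsRoot, eval_map]⟩
  have := core (Ω := Ω) he hpd h1 (Q.image (algebraMap L L⟮s⟯)) (by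
    intro x hx
    obtain ⟨y, hy, rfl⟩ := Finset.mem_image.1 hx
    have := (hQ y hy).map (algebraMap L L⟮s⟯) he
    rwa [hs'] at this)
  rw [Finset.card_image_of_injective _ (algebraMap L L⟮s⟯).injective] at this
  refine this.trans (Nat.pow_le_pow_right (by positivity) (Nat.mul_le_mul_left _ ?_))
  rw [← Module.finrank_mul_finrank (RatFunc k) L L⟮s⟯]
  exact Nat.mul_le_mul_left _ hfr

lemma mobius_id {F : Type*} [Field F] : mobiusMap (1 : F) 0 0 1 = id := by
  funext x
  cases x with
  | none => simp [mobiusMap, ratP1Map]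
  | some x => simp [mobiusMap, ratP1Map]

lemma isotrivial_of_alg {k F : Type*} [Field k] [Field F] (ι : k →+* F) {d e : ℕ} {σ : F}
    (h : AlgebraicOver ι σ) : IsotrivialMap ι (ratP1Map (X ^ d - C σ) (X ^ e)) := by
  refine ⟨1, 0, 0, 1, by simp, X ^ d - C σ, X ^ e, pow_ne_zero _ X_ne_zero, ?_, ?_, ?_⟩
  · let : Algebra k F := ι.toAlgebra
    have hσ : IsAlgebraic k σ := by
      obtain ⟨P, hP, hP0⟩ := h
      exact ⟨P, hP, by rwa [IsRoot, eval_map] at hP0⟩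
    intro n
    have : IsAlgebraic k ((X ^ d - C σ : F[X]).coeff n) := by
      rw [coeff_sub, coeff_X_pow, coeff_C]
      refine IsAlgebraic.sub ?_ ?_
      · split_ifs
        · exact isAlgebraic_one
        · exact isAlgebraic_zero
      · split_ifs
        · exact hσ
        · exact isAlgebraic_zero
    obtain ⟨P, hP, hP0⟩ := this
    exact ⟨P, hP, by rwa [IsRoot, eval_map]⟩
  · intro n
    rw [coeff_X_pow]
    split_ifs
    · exact ⟨X - 1, X_sub_C_ne_zero 1, by simp⟩
    · exact ⟨X, X_ne_zero, by simp⟩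
  · rw [neg_zero, mobius_id]; rfl

/-- Theorem 1.4 of Doyle–Faber.  Let `k` be a field of characteristic `p > 0`
and `K` a function field over `k`.  Let `d ≥ 2` and `0 ≤ e ≤ d - 2` with `p ∤ d`.  For `σ` in an
extension `L/K`, the degree-`d` map `f_σ(x) = (x^d - σ)/x^e` on `P¹(L)` (with `f_σ(∞) = ∞`,
`f_σ(0) = ∞` if `e ≥ 1` and `f_σ(0) = -σ` if `e = 0`) is exactly `ratP1Map (X^d - C σ) (X^e)`.
Then for every `D ≥ 1` there is a bound `B` such that for every extension `L/K` with
`[L : K] ≤ D` and every `σ ∈ L` with `f_σ` not isotrivial over `k`, the number of preperiodic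
points of `f_σ` in `P¹(L)` is at most `B`. -/
theorem strong_uniform_boundedness_rational_family
    (k : Type) [Field k] (p : ℕ) (hp : p ≠ 0) [CharP k p]
    (K : Type) [Field K] [Algebra (RatFunc k) K] [FiniteDimensional (RatFunc k) K]
    (d e : ℕ) (hd : 2 ≤ d) (he : e + 2 ≤ d) (hpd : ¬ p ∣ d)
    (D : ℕ) (hD : 1 ≤ D) :
    ∃ B : ℕ, ∀ (L : Type) [Field L] [Algebra K L] [FiniteDimensional K L],
      Module.finrank K L ≤ D → ∀ σ : L,
      let ι : k →+* AlgebraicClosure L :=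
        (algebraMap L (AlgebraicClosure L)).comp ((algebraMap K L).comp
          ((algebraMap (RatFunc k) K).comp RatFunc.C));
      ¬ IsotrivialMap ι
          (ratP1Map (X ^ d - C (algebraMap L (AlgebraicClosure L) σ)) (X ^ e)) →
      ({x : Option L | IsPreperiodic (ratP1Map (X ^ d - C σ) (X ^ e)) x}.Finite ∧
        {x : Option L | IsPreperiodic (ratP1Map (X ^ d - C σ) (X ^ e)) x}.ncard ≤ B) := by
  classical
  have hpp : Fact p.Prime := ⟨(CharP.char_is_prime_or_zero k p).resolve_right hp⟩
  refine ⟨((d + 1) ^ 2) ^ ((p ^ d.totient + 1) * (Module.finrank (RatFunc k) K * D * d)) + 1, ?_⟩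
  intro L _ _ _ hL σ ι hiso
  have hσ : ¬ AlgebraicOver ι (algebraMap L (AlgebraicClosure L) σ) :=
    fun h => hiso (isotrivial_of_alg ι h)
  let : Algebra (RatFunc k) L := ((algebraMap K L).comp (algebraMap (RatFunc k) K)).toAlgebra
  have : IsScalarTower (RatFunc k) K L := IsScalarTower.of_algebraMap_eq fun x => rfl
  have hfd2 : FiniteDimensional (RatFunc k) L := FiniteDimensional.trans (RatFunc k) K L
  have hb : ∀ Q : Finset L, (∀ x ∈ Q, Pre d e σ x) →
      Q.card ≤ ((d + 1) ^ 2) ^ ((p ^ d.totient + 1) * (Module.finrank (RatFunc k) K * D * d)) := by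
    intro Q hQ
    refine (core2 (k := k) (Ω := AlgebraicClosure L) he hpd hσ Q hQ).trans ?_
    refine Nat.pow_le_pow_right (by positivity) (Nat.mul_le_mul_left _ (Nat.mul_le_mul_right _ ?_))
    rw [← Module.finrank_mul_finrank (RatFunc k) K L]
    exact Nat.mul_le_mul_left _ hL
  have hfin : {x : L | Pre d e σ x}.Finite := by
    by_contra hinf
    obtain ⟨Q, hQ, hc⟩ := Set.Infinite.exists_subset_card_eq hinf
      (((d + 1) ^ 2) ^ ((p ^ d.totient + 1) * (Module.finrank (RatFunc k) K * D * d)) + 1)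
    have := hb Q fun x hx => hQ hx
    omega
  have hsub : {x : Option L | IsPreperiodic (ratP1Map (X ^ d - C σ) (X ^ e)) x} ⊆
      ((insert none (hfin.toFinset.image some) : Finset (Option L)) : Set (Option L)) := by
    intro x hx
    cases x with
    | none => simp
    | some x =>
      have hx' : Pre d e σ x := hx
      simpa using hx'
  refine ⟨(Finset.finite_toSet _).subset hsub, (Set.ncard_le_ncard hsub (Finset.finite_toSet _)).trans ?_⟩
  rw [Set.ncard_coe_finset]
  refine (Finset.card_insert_le _ _).trans (Nat.succ_le_succ (Finset.card_image_le.trans (hb _ ?_)))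
  intro x hx
  simpa using hx

end part12
end

section
/- Let F be an algebraically closed field with a nontrivial nonarchimedean absolute value ‖·‖. Let d ≥ 2, let α_1, …, α_d ∈ F satisfy ‖α_i‖ ≥ 1 for every i, and suppose R := max_i ‖α_i‖ > 1. Set f(z) = Π_{i=1}^{d} (z − α_i). Then f has a fixed point of absolute value exactly R; that is, there exists x ∈ F with f(x) = x and ‖x‖ = R. -/
lemma aux_sub_eq {F : Type} [Field F] (v : AbsoluteValue F ℝ) (hna : IsNonarchimedean v)
    {x y : F} (h : v y < v x) : v (x - y) = v x := by
  apply le_antisymm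
  · have := hna x (-y)
    rw [← sub_eq_add_neg, v.map_neg, max_eq_left h.le] at this
    exact this
  · have := hna (x - y) y
    rw [sub_add_cancel] at this
    rcases le_max_iff.1 this with h1 | h1
    · exact h1
    · linarith

/-- condition (6) in the proof of Theorem 1.1 of Doyle–Faber.  Let `F` be an
algebraically closed field with a nontrivial nonarchimedean absolute value `v`.  Let `d ≥ 2`,
let `α₁, …, α_d ∈ F` satisfy `v (αᵢ) ≥ 1` for every `i`, and suppose `R := max v (αᵢ) > 1`.
Set `f(z) = Π (z - αᵢ)`.  Then `f` has a fixed point of absolute value exactly `R`. -/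
theorem exists_fixedPoint_of_absoluteValue_eq_max
    {F : Type} [Field F] [IsAlgClosed F] (v : AbsoluteValue F ℝ)
    (hna : IsNonarchimedean v) (hnt : ∃ x : F, x ≠ 0 ∧ v x ≠ 1)
    (d : ℕ) (hd : 2 ≤ d) (α : Fin d → F) (hge : ∀ i, 1 ≤ v (α i))
    (R : ℝ) (hRmax : ∀ i, v (α i) ≤ R) (hRmem : ∃ i, v (α i) = R) (hR : 1 < R) :
    ∃ x : F, (∏ i, (x - α i)) = x ∧ v x = R := by
  classical
  by_contra hcon
  push Not at hcon
  have hpow : ∀ t : ℝ, 1 < t → t ^ d ≠ t := by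
    intro t ht h
    have h2 : t ^ 1 < t ^ d := pow_lt_pow_right₀ ht (by omega)
    rw [pow_one] at h2
    linarith
  have hlt : ∀ x : F, (∏ i, (x - α i)) = x → v x < R := by
    intro x hx
    rcases lt_trichotomy (v x) R with h | h | h
    · exact h
    · exact absurd h (hcon x hx)
    · exfalso
      apply hpow (v x) (hR.trans h)
      conv_rhs => rw [← hx]
      rw [map_prod, Finset.prod_congr rfl
        (fun i _ => aux_sub_eq v hna ((hRmax i).trans_lt h))]
      simp
  obtain ⟨i0, hi0⟩ := hRmem
  let q : Polynomial F := ∏ i, (Polynomial.X - Polynomial.C (α i))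
  have hqm : q.Monic := Polynomial.monic_prod_of_monic _ _ (fun i _ => Polynomial.monic_X_sub_C _)
  have hqd : q.natDegree = d := by
    simp [q, Polynomial.natDegree_finset_prod_X_sub_C_eq_card]
  have hXq : (Polynomial.X : Polynomial F).degree < q.degree := by
    rw [Polynomial.degree_X, Polynomial.degree_eq_natDegree hqm.ne_zero, hqd]
    exact_mod_cast hd
  have hPm : (q - Polynomial.X).Monic := hqm.sub_of_left hXq
  have hPd : (q - Polynomial.X).natDegree = d := by
    rw [Polynomial.natDegree_eq_of_degree_eq (Polynomial.degree_sub_eq_left_of_degree_lt hXq), hqd]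
  have hev : ∀ x, (q - Polynomial.X).eval x = (∏ i, (x - α i)) - x := by
    intro x
    simp [q, Polynomial.eval_prod]
  have hs : (q - Polynomial.X).Splits := IsAlgClosed.splits _
  have hcard : (q - Polynomial.X).roots.card = d := by
    rw [← hs.natDegree_eq_card_roots, hPd]
  have h1 : (q - Polynomial.X).eval (α i0) = ((q - Polynomial.X).roots.map (α i0 - ·)).prod := by
    rw [hs.eval_eq_prod_roots, hPm.leadingCoeff, one_mul]
  have h2 : v ((q - Polynomial.X).eval (α i0)) = R := by
    rw [hev, Finset.prod_eq_zero (Finset.mem_univ i0) (sub_self _), zero_sub, v.map_neg, hi0]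
  apply hpow R hR
  rw [h1, map_multiset_prod, Multiset.map_map] at h2
  have h3 : (q - Polynomial.X).roots.map (v ∘ (α i0 - ·)) =
      (q - Polynomial.X).roots.map (fun _ => R) := by
    apply Multiset.map_congr rfl
    intro r hr
    have hr0 := (Polynomial.mem_roots'.1 hr).2
    rw [Polynomial.IsRoot, hev, sub_eq_zero] at hr0
    have := hlt r hr0
    rw [← hi0] at this
    simp only [Function.comp]
    rw [aux_sub_eq v hna this, hi0]
  rw [h3, Multiset.map_const', Multiset.prod_replicate, hcard] at h2
  exact h2
end

section
/- Let F be a field with a nonarchimedean absolute value ‖·‖, let d ≥ 2 and 0 ≤ e ≤ d − 2 be integers, and assume the image of d in F has absolute value 1 (for instance, F has characteristic p > 0 and p does not divide d). Let α ∈ F with R := ‖α‖ > 1, set c = α^d, and define f(x) = (x^d − c)/x^e. Then for every y ∈ F with ‖y‖ ≤ R^{2+e−d} one has α + y ≠ 0 and ‖f(α + y)‖ = R^{d−e−1}·‖y‖ = (‖y‖ / R^{2+e−d})·R. Moreover, if F is algebraically closed, then f maps the closed disk D(α, R^{2+e−d}) = {x : ‖x − α‖ ≤ R^{2+e−d}}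 onto the closed disk D(0, R) = {w : ‖w‖ ≤ R}. -/
lemma aux_nat {F : Type} [Field F] (v : AbsoluteValue F ℝ) (hna : IsNonarchimedean v) (n : ℕ) :
    v (n : F) ≤ 1 := by
  induction n with
  | zero => simp
  | succ n ih =>
    push_cast
    exact (hna _ _).trans (max_le ih (by simp))

lemma aux_eq {F : Type} [Field F] (v : AbsoluteValue F ℝ) (hna : IsNonarchimedean v) (a b : F)
    (h : v b < v a) : v (a + b) = v a := by
  apply le_antisymm
  · exact (hna _ _).trans (max_le le_rfl h.le)
  · by_contra hc
    push Not at hc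
    have h1 := hna (a + b) (-b)
    rw [add_neg_cancel_right, v.map_neg] at h1
    exact absurd h1 (not_le.mpr (max_lt hc h))

lemma aux_pow {F : Type} [Field F] (v : AbsoluteValue F ℝ) (hna : IsNonarchimedean v)
    (α y : F) (hy : v (α + y) = v α) (n : ℕ) :
    v (α * ((α + y) ^ n - α ^ n) - n * α ^ n * y) * v α ≤ v y ^ 2 * v α ^ n := by
  induction n with
  | zero => simp
  | succ n ih =>
    have h : α * ((α + y) ^ (n + 1) - α ^ (n + 1)) - ((n + 1 : ℕ) : F) * α ^ (n + 1) * y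
        = (α + y) * (α * ((α + y) ^ n - α ^ n) - n * α ^ n * y) + n * α ^ n * y ^ 2 := by
      push_cast; ring
    rw [h]
    have ha := v.nonneg α
    refine (mul_le_mul_of_nonneg_right (hna _ _) ha).trans ?_
    rw [max_mul_of_nonneg _ _ ha]
    apply max_le
    · rw [v.map_mul, hy, pow_succ (v α)]
      nlinarith
    · simp only [v.map_mul, v.map_pow]
      have h1 := mul_le_mul_of_nonneg_right (aux_nat v hna n)
        (show 0 ≤ v y ^ 2 * v α ^ (n + 1) by positivity)
      rw [pow_succ (v α)] at h1 ⊢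
      linarith

lemma aux_root {F : Type} [Field F] (v : AbsoluteValue F ℝ) (hna : IsNonarchimedean v)
    (α : F) (ρ : ℝ) (hρ : 0 < ρ) (s : Multiset F) (hs : ∀ a ∈ s, ρ < v (α - a)) :
    v ((s.map (fun a => Polynomial.X - Polynomial.C a)).prod.derivative.eval α) * ρ
      < v ((s.map (fun a => Polynomial.X - Polynomial.C a)).prod.eval α) := by
  induction s using Multiset.induction_on with
  | empty => simp
  | cons a s ih =>
    have ih := ih (fun b hb => hs b (Multiset.mem_cons_of_mem hb))
    have ha := hs a (Multiset.mem_cons_self a s)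
    rw [Multiset.map_cons, Multiset.prod_cons]
    set Q := (s.map (fun a => Polynomial.X - Polynomial.C a)).prod
    simp only [Polynomial.derivative_mul, Polynomial.derivative_sub, Polynomial.derivative_X,
      Polynomial.derivative_C, sub_zero, one_mul, Polynomial.eval_add, Polynomial.eval_mul,
      Polynomial.eval_sub, Polynomial.eval_X, Polynomial.eval_C, v.map_mul]
    refine (mul_le_mul_of_nonneg_right (hna _ _) hρ.le).trans_lt ?_
    rw [max_mul_of_nonneg _ _ hρ.le]
    have h0 : 0 < v (Q.eval α) := lt_of_le_of_lt (by positivity) ih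
    apply max_lt
    · rw [mul_comm]; exact mul_lt_mul_of_pos_right ha h0
    · rw [v.map_mul, mul_assoc]; exact mul_lt_mul_of_pos_left ih (hρ.trans ha)

/-- condition (7) in the proof of Theorem 1.4 of Doyle–Faber.  Let `F` be a
field with a nonarchimedean absolute value `v`, let `d ≥ 2` and `0 ≤ e ≤ d - 2` be integers, and
assume the image of `d` in `F` has absolute value `1`.  Let `α ∈ F` with `R := v α > 1`, set
`c = α^d` and `f(x) = (x^d - c)/x^e`.  Then for every `y` with `v y ≤ R^(2+e-d)` one has
`α + y ≠ 0` and `v (f (α + y)) = R^(d-e-1) · v y = (v y / R^(2+e-d)) · R`; moreover if `F` is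
algebraically closed then `f` maps the closed disk `D(α, R^(2+e-d))` onto the closed disk
`D(0, R)`. -/
theorem maps_disk_onto_disk_unicritical
    {F : Type} [Field F] (v : AbsoluteValue F ℝ) (hna : IsNonarchimedean v)
    (d e : ℕ) (hd : 2 ≤ d) (he : e + 2 ≤ d) (hvd : v ((d : F)) = 1)
    (α : F) (R : ℝ) (hR : R = v α) (hR1 : 1 < R) :
    (∀ y : F, v y ≤ R ^ ((2 : ℤ) + (e : ℤ) - (d : ℤ)) →
      α + y ≠ 0 ∧
      v (((α + y) ^ d - α ^ d) / (α + y) ^ e) = R ^ ((d : ℤ) - (e : ℤ) - 1) * v y ∧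
      v (((α + y) ^ d - α ^ d) / (α + y) ^ e) =
        (v y / R ^ ((2 : ℤ) + (e : ℤ) - (d : ℤ))) * R) ∧
    (IsAlgClosed F →
      (fun x => (x ^ d - α ^ d) / x ^ e) ''
          {x | v (x - α) ≤ R ^ ((2 : ℤ) + (e : ℤ) - (d : ℤ))} =
        {w | v w ≤ R}) := by
  have hα0 : α ≠ 0 := by
    rintro rfl
    simp at hR; linarith
  have hR0 : 0 < R := by linarith
  obtain ⟨k, rfl⟩ : ∃ k, d = e + 2 + k := ⟨d - (e + 2), by omega⟩
  have e1 : R ^ ((2 : ℤ) + (e : ℤ) - ((e + 2 + k : ℕ) : ℤ)) = (R ^ k)⁻¹ := by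
    rw [← zpow_natCast, ← zpow_neg]; congr 1; push_cast; ring
  have e2 : R ^ (((e + 2 + k : ℕ) : ℤ) - (e : ℤ) - 1) = R ^ (k + 1) := by
    rw [← zpow_natCast]; congr 1; push_cast; ring
  rw [e1, e2]
  have hk : (R ^ k)⁻¹ ≤ 1 := inv_le_one_of_one_le₀ (one_le_pow₀ hR1.le)
  have main : ∀ y : F, v y ≤ (R ^ k)⁻¹ →
      α + y ≠ 0 ∧
      v (((α + y) ^ (e + 2 + k) - α ^ (e + 2 + k)) / (α + y) ^ e) = R ^ (k + 1) * v y := by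
    intro y hy
    have hyR : v y < R := by linarith
    have hz : v (α + y) = v α := aux_eq v hna _ _ (by rw [← hR]; exact hyR)
    have hz0 : α + y ≠ 0 := by
      rw [← v.pos_iff, hz, ← hR]; exact hR0
    refine ⟨hz0, ?_⟩
    rcases eq_or_ne y 0 with rfl | hy0
    · simp
    have hvy : 0 < v y := v.pos hy0
    have hp := aux_pow v hna α y hz (e + 2 + k)
    rw [← hR] at hp
    have hlt : v (α * ((α + y) ^ (e + 2 + k) - α ^ (e + 2 + k))
        - ((e + 2 + k : ℕ) : F) * α ^ (e + 2 + k) * y)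
        < v (((e + 2 + k : ℕ) : F) * α ^ (e + 2 + k) * y) := by
      rw [v.map_mul (_ * _), v.map_mul, hvd, v.map_pow, ← hR]
      refine lt_of_mul_lt_mul_right (hp.trans_lt ?_) hR0.le
      have : 0 < v y * R ^ (e + 2 + k) := by positivity
      nlinarith
    have h := aux_eq v hna _ _ hlt
    rw [add_sub_cancel, v.map_mul (_ * _), v.map_mul, v.map_mul, hvd, v.map_pow, ← hR] at h
    rw [map_div₀, v.map_pow, hz, ← hR, div_eq_iff (by positivity)]
    apply mul_left_cancel₀ hR0.ne'
    rw [h]; ring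
  refine ⟨fun y hy => ⟨(main y hy).1, (main y hy).2, ?_⟩, ?_⟩
  · rw [(main y hy).2, div_inv_eq_mul]; ring
  intro hac
  ext w
  simp only [Set.mem_image, Set.mem_ofPred_eq]
  constructor
  · rintro ⟨x, hx, rfl⟩
    have h := (main (x - α) hx).2
    rw [add_sub_cancel] at h
    rw [h]
    calc R ^ (k + 1) * v (x - α) ≤ R ^ (k + 1) * (R ^ k)⁻¹ := by gcongr
      _ = R := by rw [pow_succ]; field_simp
  · intro hw
    let P : Polynomial F := Polynomial.X ^ (e + 2 + k) -
      (Polynomial.C w * Polynomial.X ^ e + Polynomial.C (α ^ (e + 2 + k)))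
    have hdeg : (Polynomial.C w * Polynomial.X ^ e + Polynomial.C (α ^ (e + 2 + k))).degree
        < ((e + 2 + k : ℕ) : WithBot ℕ) := by
      refine (Polynomial.degree_add_le _ _).trans_lt (max_lt ?_ ?_)
      · refine (Polynomial.degree_C_mul_X_pow_le _ _).trans_lt ?_
        exact_mod_cast (by omega : e < e + 2 + k)
      · refine Polynomial.degree_C_le.trans_lt ?_
        exact_mod_cast (by omega : 0 < e + 2 + k)
    have hmon : P.Monic := Polynomial.monic_X_pow_sub hdeg
    have hprod : (P.roots.map (fun a => Polynomial.X - Polynomial.C a)).prod = P :=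
      ((IsAlgClosed.splits P).eq_prod_roots_of_monic hmon).symm
    have hex : ∃ x ∈ P.roots, v (α - x) ≤ (R ^ k)⁻¹ := by
      by_contra hc
      push Not at hc
      have h := aux_root v hna α _ (by positivity) P.roots hc
      rw [hprod] at h
      have h1 : P.eval α = - (w * α ^ e) := by simp [P]
      have h2 : P.derivative.eval α = ((e + 2 + k : ℕ) : F) * α ^ (e + 1 + k)
          + - (w * (e * α ^ (e - 1))) := by
        have : e + 2 + k - 1 = e + 1 + k := by omega
        simp only [P, Polynomial.derivative_sub, Polynomial.derivative_add,
          Polynomial.derivative_X_pow, Polynomial.derivative_C_mul, Polynomial.derivative_C, this]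
        simp
        ring
      have h3 : v (P.derivative.eval α) = R ^ (e + 1 + k) := by
        rw [h2, aux_eq v hna]
        · rw [v.map_mul, hvd, v.map_pow, ← hR, one_mul]
        · rw [v.map_neg, v.map_mul, v.map_mul, v.map_mul, hvd, v.map_pow, v.map_pow, ← hR, one_mul]
          rcases Nat.eq_zero_or_pos e with rfl | hepos
          · simp; positivity
          · calc v w * (v (e : F) * R ^ (e - 1)) ≤ R * (1 * R ^ (e - 1)) := by
                  gcongr
                  exact aux_nat v hna e
              _ = R ^ e := by
                  rw [one_mul, ← pow_succ']; congr 1; omega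
              _ < R ^ (e + 1 + k) := pow_lt_pow_right₀ hR1 (by omega)
      rw [h3, h1, v.map_neg, v.map_mul, v.map_pow, ← hR] at h
      have h4 : R ^ (e + 1 + k) * (R ^ k)⁻¹ = R * R ^ e := by
        field_simp; ring
      rw [h4] at h
      exact absurd h (not_lt.mpr (by gcongr))
    obtain ⟨x, hx, hxv⟩ := hex
    rw [v.map_sub] at hxv
    refine ⟨x, hxv, ?_⟩
    have hx0 := (main (x - α) hxv).1
    rw [add_sub_cancel] at hx0
    have hr := (Polynomial.mem_roots'.mp hx).2
    simp only [P, Polynomial.IsRoot.def, Polynomial.eval_sub, Polynomial.eval_add,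
      Polynomial.eval_mul, Polynomial.eval_pow, Polynomial.eval_X, Polynomial.eval_C] at hr
    rw [div_eq_iff (pow_ne_zero _ hx0)]
    linear_combination hr
end
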